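/- arXiv:2409.08756 — 10 statements merged into one kernel-verified Lean document; each statement's English description precedes it below -/
import Mathlib

section
/- For the generic quadratic model f with an admissible design x_1,…,x_n and arbitrary observations y = (y_1,…,y_n) ∈ ℝ^n, the sum of squared errors S(θ) = Σ_{i=1}^n (f(x_i,θ) − y_i)^2 has a unique global minimizer over ℝ^{d+1}, and it is given by θ̂(y) = (θ̂_0, θ̂_1, …, θ̂_d) with θ̂_0 = (1/n) Σ_{i=1}^n y_i − Σ_{k=1}^d (β_k/(2 α_k^2 n^2)) (Σ_{i=1}^n x_{i,k} y_i)^2 and θ̂_k = (1/(α_k n)) Σ_{i=1}^n x_{i,k} y_i for k = 1,…,d. -/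
open Finset MeasureTheory Real

/-- The generic quadratic model
`f(x,θ) = θ₀ + ∑ₖ αₖ θₖ xₖ + ∑ₖ βₖ (θₖ²/2) xₖ²`. -/
noncomputable def model (d : ℕ) (α β : Fin d → ℝ) (x : Fin d → ℝ)
    (θ : Fin (d + 1) → ℝ) : ℝ :=
  θ 0 + (∑ k, α k * θ k.succ * x k) + (∑ k, β k * (θ k.succ) ^ 2 / 2 * (x k) ^ 2)

/-- Admissibility of an experimental design: all design points are corners of `[-1,1]^d`,
they sum to zero, and the design is orthogonal. -/
def Admissible (d n : ℕ) (X : Fin n → Fin d → ℝ) : Prop :=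
  (∀ i k, X i k = 1 ∨ X i k = -1) ∧
  (∀ k, ∑ i, X i k = 0) ∧
  (∀ k l, ∑ i, X i k * X i l = (n : ℝ) * (if k = l then 1 else 0))

/-- The closed-form least-squares estimator for the generic quadratic model. -/
noncomputable def lse (d n : ℕ) (α β : Fin d → ℝ) (X : Fin n → Fin d → ℝ)
    (y : Fin n → ℝ) : Fin (d + 1) → ℝ :=
  Fin.cons
    ((1 / (n : ℝ)) * (∑ i, y i)
      - ∑ k, β k / (2 * (α k) ^ 2 * (n : ℝ) ^ 2) * (∑ i, X i k * y i) ^ 2)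
    (fun k => (1 / (α k * (n : ℝ))) * ∑ i, X i k * y i)

/-- The sum of squared errors. -/
noncomputable def sse (d n : ℕ) (α β : Fin d → ℝ) (X : Fin n → Fin d → ℝ)
    (y : Fin n → ℝ) (θ : Fin (d + 1) → ℝ) : ℝ :=
  ∑ i, (model d α β (X i) θ - y i) ^ 2

theorem aux_expand (d n : ℕ) (X : Fin n → Fin d → ℝ) (hX : Admissible d n X)
    (y : Fin n → ℝ) (a : ℝ) (b : Fin d → ℝ) :
    ∑ i, (a + ∑ k, b k * X i k - y i) ^ 2
      = n * a ^ 2 - 2 * a * (∑ i, y i) + ∑ k, (n * b k ^ 2 - 2 * b k * ∑ i, X i k * y i)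
        + ∑ i, y i ^ 2 := by
  obtain ⟨-, h0, h1⟩ := hX
  have e1 : ∑ i, ∑ k, b k * X i k = 0 := by
    rw [Finset.sum_comm]
    simp [← Finset.mul_sum, h0]
  have e2 : ∑ i, (∑ k, b k * X i k) * y i = ∑ k, b k * ∑ i, X i k * y i := by
    simp_rw [Finset.sum_mul, Finset.mul_sum]
    rw [Finset.sum_comm]
    simp_rw [mul_assoc]
  have e3 : ∑ i, (∑ k, b k * X i k) ^ 2 = ∑ k, n * b k ^ 2 := by
    simp_rw [pow_two, Finset.sum_mul_sum]
    rw [Finset.sum_comm]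
    refine Finset.sum_congr rfl fun k _ => ?_
    rw [Finset.sum_comm]
    have : ∀ l, ∑ i, b k * X i k * (b l * X i l) = b k * b l * (n * (if k = l then 1 else 0)) := by
      intro l
      rw [← h1 k l, Finset.mul_sum]
      refine Finset.sum_congr rfl fun i _ => by ring
    simp_rw [this]
    simp
    ring
  have e4 : ∀ i, (a + ∑ k, b k * X i k - y i) ^ 2 = a ^ 2 + 2 * a * (∑ k, b k * X i k)
      - 2 * a * y i + (∑ k, b k * X i k) ^ 2 - 2 * ((∑ k, b k * X i k) * y i) + y i ^ 2 := by
    intro i; ring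
  simp_rw [e4, Finset.sum_add_distrib, Finset.sum_sub_distrib, Finset.sum_add_distrib,
    Finset.sum_sub_distrib, Finset.sum_add_distrib, ← Finset.mul_sum, e1, e2, e3]
  have e5 : ∑ k, 2 * b k * ∑ i, X i k * y i = 2 * ∑ k, b k * ∑ i, X i k * y i := by
    rw [Finset.mul_sum]
    refine Finset.sum_congr rfl fun i _ => by ring
  rw [e5, ← Finset.mul_sum]
  simp
  ring

theorem aux_sse (d n : ℕ) (α β : Fin d → ℝ) (X : Fin n → Fin d → ℝ) (hX : Admissible d n X)
    (y : Fin n → ℝ) (θ : Fin (d + 1) → ℝ) :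
    sse d n α β X y θ = ∑ i, ((θ 0 + ∑ k, β k * (θ k.succ) ^ 2 / 2)
      + ∑ k, (α k * θ k.succ) * X i k - y i) ^ 2 := by
  unfold sse model
  refine Finset.sum_congr rfl fun i _ => ?_
  have : ∀ k, X i k ^ 2 = 1 := by
    intro k
    rcases hX.1 i k with h | h <;> simp [h]
  simp_rw [this, mul_one]
  ring

/-- For the generic quadratic model with an admissible design and arbitrary
observations, the sum of squared errors has a unique global minimizer, given by the
closed-form least-squares estimator `lse`. -/
theorem stmt0 (d n : ℕ) (hd : 1 ≤ d) (hn : 1 ≤ n)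
    (α β : Fin d → ℝ) (hα : ∀ k, α k ≠ 0)
    (X : Fin n → Fin d → ℝ) (hX : Admissible d n X)
    (y : Fin n → ℝ) :
    ∀ θ : Fin (d + 1) → ℝ, θ ≠ lse d n α β X y →
      sse d n α β X y (lse d n α β X y) < sse d n α β X y θ := by
  intro θ hθ
  have hn' : (0 : ℝ) < n := by exact_mod_cast hn
  rw [aux_sse d n α β X hX, aux_sse d n α β X hX, aux_expand d n X hX, aux_expand d n X hX]
  have hs : ∀ k : Fin d, lse d n α β X y k.succ = (1 / (α k * (n : ℝ))) * ∑ i, X i k * y i := by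
    intro k; simp [lse]
  have hz : lse d n α β X y 0 = (1 / (n : ℝ)) * (∑ i, y i)
      - ∑ k, β k * (lse d n α β X y k.succ) ^ 2 / 2 := by
    simp_rw [hs]
    simp only [lse, Fin.cons_zero]
    congr 1
    refine Finset.sum_congr rfl fun k _ => ?_
    have := hα k
    field_simp
  have hb : ∀ k : Fin d, ∑ i, X i k * y i = n * (α k * lse d n α β X y k.succ) := by
    intro k
    rw [hs]
    have := hα k
    field_simp
  have ha : ∑ i, y i = n * (lse d n α β X y 0
      + ∑ k, β k * (lse d n α β X y k.succ) ^ 2 / 2) := by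
    rw [hz]
    field_simp
    ring
  rw [ha]
  simp_rw [hb]
  generalize lse d n α β X y = η at *
  set A := η 0 + ∑ k, β k * (η k.succ) ^ 2 / 2 with hA
  set B := θ 0 + ∑ k, β k * (θ k.succ) ^ 2 / 2 with hB
  have key : ∑ k, (n * (α k * θ k.succ) ^ 2 - 2 * (α k * θ k.succ) * (n * (α k * η k.succ)))
      = ∑ k, (n * (α k * η k.succ) ^ 2 - 2 * (α k * η k.succ) * (n * (α k * η k.succ)))
        + ∑ k, n * (α k * (θ k.succ - η k.succ)) ^ 2 := by
    rw [← Finset.sum_add_distrib]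
    refine Finset.sum_congr rfl fun k _ => by ring
  rw [key]
  have hnn : ∀ k ∈ Finset.univ, 0 ≤ n * (α k * (θ k.succ - η k.succ)) ^ 2 := by
    intro k _; positivity
  have hpos : 0 < n * (B - A) ^ 2 + ∑ k, n * (α k * (θ k.succ - η k.succ)) ^ 2 := by
    have h1 : 0 ≤ n * (B - A) ^ 2 := by positivity
    have h2 := Finset.sum_nonneg hnn
    by_contra hcon
    have h3 : ∑ k, n * (α k * (θ k.succ - η k.succ)) ^ 2 = 0 := by linarith
    have h4 : n * (B - A) ^ 2 = 0 := by linarith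
    rw [Finset.sum_eq_zero_iff_of_nonneg hnn] at h3
    have h5 : ∀ k : Fin d, θ k.succ = η k.succ := by
      intro k
      have := h3 k (Finset.mem_univ k)
      simp [hn'.ne', hα k] at this
      linarith
    have h6 : B = A := by
      simp [hn'.ne'] at h4
      linarith
    apply hθ
    funext j
    refine Fin.cases ?_ h5 j
    simp_rw [hA, hB, h5] at h6
    linarith
  nlinarith [hpos]
end

section
/- For the generic quadratic model f with an admissible design x_1,…,x_n and arbitrary observations y ∈ ℝ^n, let θ̂ = θ̂(y) be the least-squares estimator and let ∇²S(θ̂) be the Hessian matrix of the sum of squared errors S(θ) = Σ_{i=1}^n (f(x_i,θ) − y_i)^2 at θ̂. Then for every v = (v_0, v_1, …, v_d) ∈ ℝ^{d+1}, v^T ∇²S(θ̂) v = 2n (Σ_{k=1}^d α_k^2 v_k^2 + (v_0 + Σ_{k=1}^d β_k θ̂_k v_k)^2); in particular, ∇²S(θ̂) is positive definite. -/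
open Finset MeasureTheory Real

/-- The common constant term. -/
noncomputable def cc (d : ℕ) (β : Fin d → ℝ) (θ : Fin (d + 1) → ℝ) : ℝ :=
  θ 0 + ∑ k, β k / 2 * (θ k.succ * θ k.succ)

/-- Coordinate projection. -/
noncomputable def pr (d : ℕ) (k : Fin (d + 1)) : (Fin (d + 1) → ℝ) →L[ℝ] ℝ :=
  ContinuousLinearMap.proj k

lemma pr_apply (d : ℕ) (k : Fin (d + 1)) (v : Fin (d + 1) → ℝ) : pr d k v = v k := rfl

lemma hasFDerivAt_pr (d : ℕ) (k : Fin (d + 1)) (θ : Fin (d + 1) → ℝ) :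
    HasFDerivAt (fun θ : Fin (d + 1) → ℝ => θ k) (pr d k) θ := (pr d k).hasFDerivAt

/-- Derivative of the constant term. -/
noncomputable def dcc (d : ℕ) (β : Fin d → ℝ) (θ : Fin (d + 1) → ℝ) :
    (Fin (d + 1) → ℝ) →L[ℝ] ℝ :=
  pr d 0 + ∑ k : Fin d, (θ k.succ) • (β k • pr d k.succ)

lemma dcc_apply (d : ℕ) (β : Fin d → ℝ) (θ v : Fin (d + 1) → ℝ) :
    dcc d β θ v = v 0 + ∑ k, β k * θ k.succ * v k.succ := by
  simp only [dcc, ContinuousLinearMap.add_apply, ContinuousLinearMap.sum_apply,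
    ContinuousLinearMap.smul_apply, pr_apply, smul_eq_mul]
  congr 1
  exact Finset.sum_congr rfl fun k _ => by ring

lemma hasFDerivAt_cc (d : ℕ) (β : Fin d → ℝ) (θ : Fin (d + 1) → ℝ) :
    HasFDerivAt (cc d β) (dcc d β θ) θ := by
  have h := (hasFDerivAt_pr d 0 θ).add (HasFDerivAt.fun_sum (u := Finset.univ) fun (k : Fin d) _ =>
    ((hasFDerivAt_pr d k.succ θ).mul (hasFDerivAt_pr d k.succ θ)).const_mul (β k / 2))
  refine HasFDerivAt.congr_fderiv h ?_
  ext1 v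
  rw [dcc_apply]
  simp only [ContinuousLinearMap.add_apply, ContinuousLinearMap.sum_apply,
    ContinuousLinearMap.smul_apply, pr_apply, smul_eq_mul]
  congr 1
  exact Finset.sum_congr rfl fun k _ => by ring

lemma hasFDerivAt_dcc (d : ℕ) (β : Fin d → ℝ) (θ : Fin (d + 1) → ℝ) :
    HasFDerivAt (dcc d β)
      (∑ k : Fin d, (pr d k.succ).smulRight (β k • pr d k.succ)) θ := by
  have h := (HasFDerivAt.fun_sum (u := Finset.univ) fun (k : Fin d) _ =>
    (hasFDerivAt_pr d k.succ θ).smul_const (β k • pr d k.succ)).const_add (pr d 0)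
  exact h

lemma sse_eq (d n : ℕ) (hn : 1 ≤ n) (α β : Fin d → ℝ)
    (X : Fin n → Fin d → ℝ) (hX : Admissible d n X) (y : Fin n → ℝ) (θ : Fin (d + 1) → ℝ) :
    sse d n α β X y θ = (n : ℝ) * (cc d β θ * cc d β θ) - 2 * (∑ i, y i) * cc d β θ
      + (∑ k, ((n : ℝ) * α k ^ 2 * (θ k.succ * θ k.succ)
          - 2 * α k * (∑ i, X i k * y i) * θ k.succ)) + ∑ i, y i ^ 2 := by
  obtain ⟨h1, h2, h3⟩ := hX
  have hm : ∀ i, model d α β (X i) θ = cc d β θ + ∑ k, α k * θ k.succ * X i k := by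
    intro i
    have : ∀ k, X i k ^ 2 = 1 := fun k => by rcases h1 i k with h | h <;> rw [h] <;> norm_num
    simp only [model, cc, this]
    rw [add_right_comm]
    congr 2
    exact Finset.sum_congr rfl fun k _ => by ring
  have hL : ∑ i, ∑ k, α k * θ k.succ * X i k = 0 := by
    rw [Finset.sum_comm]
    refine Finset.sum_eq_zero fun k _ => ?_
    rw [← Finset.mul_sum, h2, mul_zero]
  have hLL : ∑ i, (∑ k, α k * θ k.succ * X i k) ^ 2
      = ∑ k, (n : ℝ) * α k ^ 2 * (θ k.succ * θ k.succ) := by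
    simp only [sq, Finset.sum_mul_sum]
    rw [Finset.sum_comm]
    refine Finset.sum_congr rfl fun k _ => ?_
    rw [Finset.sum_comm]
    have : ∀ l, ∑ i, α k * θ k.succ * X i k * (α l * θ l.succ * X i l)
        = α k * θ k.succ * (α l * θ l.succ) * ((n : ℝ) * (if k = l then 1 else 0)) := by
      intro l
      rw [← h3, Finset.mul_sum]
      exact Finset.sum_congr rfl fun i _ => by ring
    simp only [this]
    simp
    ring
  have hLy : ∑ i, (∑ k, α k * θ k.succ * X i k) * y i
      = ∑ k, α k * (∑ i, X i k * y i) * θ k.succ := by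
    simp only [Finset.sum_mul, Finset.mul_sum]
    rw [Finset.sum_comm]
    exact Finset.sum_congr rfl fun k _ => Finset.sum_congr rfl fun i _ => by ring
  have hs : ∀ i, (model d α β (X i) θ - y i) ^ 2 = cc d β θ * cc d β θ
      + 2 * cc d β θ * (∑ k, α k * θ k.succ * X i k) - 2 * cc d β θ * y i
      + (∑ k, α k * θ k.succ * X i k) ^ 2 - 2 * ((∑ k, α k * θ k.succ * X i k) * y i)
      + y i ^ 2 := fun i => by rw [hm]; ring
  have h2y : ∑ k, 2 * α k * (∑ i, X i k * y i) * θ k.succ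
      = 2 * ∑ k, α k * (∑ i, X i k * y i) * θ k.succ := by
    rw [Finset.mul_sum]
    exact Finset.sum_congr rfl fun k _ => by ring
  simp only [sse, hs, Finset.sum_add_distrib, Finset.sum_sub_distrib, ← Finset.mul_sum, hL, hLL,
    hLy, h2y]
  simp only [Finset.sum_const, Finset.card_univ, Fintype.card_fin, nsmul_eq_mul]
  ring

/-- Derivative of the sum of squared errors. -/
noncomputable def dsse (d n : ℕ) (α β : Fin d → ℝ) (X : Fin n → Fin d → ℝ)
    (y : Fin n → ℝ) (θ : Fin (d + 1) → ℝ) : (Fin (d + 1) → ℝ) →L[ℝ] ℝ :=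
  (2 * (n : ℝ) * cc d β θ - 2 * ∑ i, y i) • dcc d β θ
    + ∑ k : Fin d, (2 * (n : ℝ) * α k ^ 2 * θ k.succ - 2 * α k * ∑ i, X i k * y i) • pr d k.succ

lemma hasFDerivAt_sse (d n : ℕ) (hn : 1 ≤ n) (α β : Fin d → ℝ)
    (X : Fin n → Fin d → ℝ) (hX : Admissible d n X) (y : Fin n → ℝ) (θ : Fin (d + 1) → ℝ) :
    HasFDerivAt (sse d n α β X y) (dsse d n α β X y θ) θ := by
  rw [funext (sse_eq d n hn α β X hX y)]
  have hc := hasFDerivAt_cc d β θ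
  have h := ((((hc.mul hc).const_mul (n : ℝ)).sub (hc.const_mul (2 * ∑ i, y i))).add
    (HasFDerivAt.fun_sum (u := Finset.univ) fun (k : Fin d) _ =>
      (((hasFDerivAt_pr d k.succ θ).mul (hasFDerivAt_pr d k.succ θ)).const_mul
        ((n : ℝ) * α k ^ 2)).sub
        ((hasFDerivAt_pr d k.succ θ).const_mul (2 * α k * ∑ i, X i k * y i)))).add_const
          (∑ i, y i ^ 2)
  refine HasFDerivAt.congr_fderiv h ?_
  ext1 v
  simp only [dsse, ContinuousLinearMap.add_apply, ContinuousLinearMap.sub_apply,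
    ContinuousLinearMap.sum_apply, ContinuousLinearMap.smul_apply, pr_apply, smul_eq_mul]
  congr 1
  · ring
  · exact Finset.sum_congr rfl fun k _ => by ring

lemma cc_lse (d n : ℕ) (hn : 1 ≤ n) (α β : Fin d → ℝ) (hα : ∀ k, α k ≠ 0)
    (X : Fin n → Fin d → ℝ) (y : Fin n → ℝ) :
    2 * (n : ℝ) * cc d β (lse d n α β X y) - 2 * ∑ i, y i = 0 := by
  have hn' : (n : ℝ) ≠ 0 := by positivity
  have : cc d β (lse d n α β X y) = (1 / (n : ℝ)) * ∑ i, y i := by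
    simp only [cc, lse, Fin.cons_zero, Fin.cons_succ]
    rw [sub_add_eq_add_sub, sub_eq_iff_eq_add]
    congr 1
    refine Finset.sum_congr rfl fun k _ => ?_
    have := hα k
    field_simp
  rw [this]
  field_simp
  ring

lemma hess (d n : ℕ) (hn : 1 ≤ n) (α β : Fin d → ℝ) (hα : ∀ k, α k ≠ 0)
    (X : Fin n → Fin d → ℝ) (hX : Admissible d n X) (y : Fin n → ℝ) (v : Fin (d + 1) → ℝ) :
    (fderiv ℝ (fderiv ℝ (sse d n α β X y)) (lse d n α β X y) v) v
          = 2 * (n : ℝ) * ((∑ k, (α k) ^ 2 * (v k.succ) ^ 2)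
              + (v 0 + ∑ k, β k * lse d n α β X y k.succ * v k.succ) ^ 2) := by
  have h1 : fderiv ℝ (sse d n α β X y) = dsse d n α β X y :=
    funext fun θ => (hasFDerivAt_sse d n hn α β X hX y θ).fderiv
  rw [h1]
  set θ := lse d n α β X y with hθ
  have hc := ((hasFDerivAt_cc d β θ).const_mul (2 * (n : ℝ))).sub_const (2 * ∑ i, y i)
  have h := (hc.smul (hasFDerivAt_dcc d β θ)).add
    (HasFDerivAt.fun_sum (u := Finset.univ) fun (k : Fin d) _ =>
      (((hasFDerivAt_pr d k.succ θ).const_mul (2 * (n : ℝ) * α k ^ 2)).sub_const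
        (2 * α k * ∑ i, X i k * y i)).smul_const (pr d k.succ))
  have h' : HasFDerivAt (dsse d n α β X y) _ θ := h
  rw [h'.fderiv, cc_lse d n hn α β hα X y]
  simp only [ContinuousLinearMap.add_apply, ContinuousLinearMap.sum_apply, zero_smul,
    ContinuousLinearMap.smul_apply, ContinuousLinearMap.smulRight_apply, pr_apply, smul_eq_mul,
    dcc_apply, zero_add]
  have hs : ∑ k, 2 * (n : ℝ) * α k ^ 2 * v k.succ * v k.succ
      = 2 * (n : ℝ) * ∑ k, α k ^ 2 * v k.succ ^ 2 := by
    rw [Finset.mul_sum]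
    exact Finset.sum_congr rfl fun k _ => by ring
  rw [hs]
  ring

/-- The Hessian quadratic form of the sum of squared errors at the
least-squares estimator, and its positive definiteness. -/
theorem stmt2 (d n : ℕ) (hd : 1 ≤ d) (hn : 1 ≤ n)
    (α β : Fin d → ℝ) (hα : ∀ k, α k ≠ 0)
    (X : Fin n → Fin d → ℝ) (hX : Admissible d n X)
    (y : Fin n → ℝ) :
    ∀ v : Fin (d + 1) → ℝ,
      (fderiv ℝ (fderiv ℝ (sse d n α β X y)) (lse d n α β X y) v) v
          = 2 * (n : ℝ) * ((∑ k, (α k) ^ 2 * (v k.succ) ^ 2)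
              + (v 0 + ∑ k, β k * lse d n α β X y k.succ * v k.succ) ^ 2)
        ∧ (v ≠ 0 →
            0 < (fderiv ℝ (fderiv ℝ (sse d n α β X y)) (lse d n α β X y) v) v) := by
  intro v
  rw [hess d n hn α β hα X hX y v]
  refine ⟨rfl, fun hv => ?_⟩
  have hn' : (0 : ℝ) < n := by exact_mod_cast hn
  refine mul_pos (by positivity) ?_
  have hnn : 0 ≤ ∑ k, (α k) ^ 2 * (v k.succ) ^ 2 := Finset.sum_nonneg fun k _ => by positivity
  by_cases hz : ∀ k : Fin d, v k.succ = 0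
  · have h0 : v 0 ≠ 0 := by
      intro h0
      apply hv
      funext j
      refine Fin.cases h0 hz j
    simp only [hz]
    simp
    positivity
  · push Not at hz
    obtain ⟨k, hk⟩ := hz
    have : 0 < ∑ k, (α k) ^ 2 * (v k.succ) ^ 2 :=
      Finset.sum_pos' (fun k _ => by positivity)
        ⟨k, Finset.mem_univ k, by have := hα k; positivity⟩
    positivity
end

section
/- For the generic quadratic model f with an admissible design x_1,…,x_n, the least-squares estimator recovers the generating parameter exactly on noise-free data: for every θ ∈ ℝ^{d+1}, if y_i = f(x_i, θ) for all i = 1,…,n, then θ̂(y) = θ. -/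
open Finset MeasureTheory Real

/-- On noise-free data the least-squares estimator recovers the
generating parameter exactly. -/
theorem stmt3 (d n : ℕ) (hd : 1 ≤ d) (hn : 1 ≤ n)
    (α β : Fin d → ℝ) (hα : ∀ k, α k ≠ 0)
    (X : Fin n → Fin d → ℝ) (hX : Admissible d n X)
    (θ : Fin (d + 1) → ℝ) (y : Fin n → ℝ)
    (hy : ∀ i, y i = model d α β (X i) θ) :
    lse d n α β X y = θ := by
  obtain ⟨h1, h2, h3⟩ := hX
  have hn0 : (n : ℝ) ≠ 0 := by
    have : n ≠ 0 := by omega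
    exact_mod_cast this
  set C : ℝ := θ 0 + ∑ k, β k * (θ k.succ) ^ 2 / 2 with hC
  have hy' : ∀ i, y i = C + ∑ k, α k * θ k.succ * X i k := by
    intro i
    have hsq : ∀ k, (X i k) ^ 2 = 1 := by
      intro k
      rcases h1 i k with h | h <;> rw [h] <;> norm_num
    rw [hy i, model, hC]
    simp only [hsq, mul_one]
    ring
  have hsum : ∑ i, y i = n * C := by
    simp only [hy', Finset.sum_add_distrib]
    rw [Finset.sum_comm]
    simp [← Finset.mul_sum, h2]
  have hXy : ∀ k, ∑ i, X i k * y i = n * (α k * θ k.succ) := by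
    intro k
    have e : ∀ i, X i k * y i
        = C * X i k + ∑ l, α l * θ l.succ * (X i k * X i l) := by
      intro i
      rw [hy' i, mul_add, Finset.mul_sum, mul_comm C]
      congr 1
      exact Finset.sum_congr rfl fun l _ => by ring
    simp only [e, Finset.sum_add_distrib]
    rw [Finset.sum_comm]
    simp only [← Finset.mul_sum, h2, h3]
    simp
    ring
  funext j
  refine Fin.cases ?_ (fun k => ?_) j
  · simp only [lse, Fin.cons_zero, hsum, hXy]
    have e : ∀ k, β k / (2 * (α k) ^ 2 * (n : ℝ) ^ 2) * (n * (α k * θ k.succ)) ^ 2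
        = β k * (θ k.succ) ^ 2 / 2 := by
      intro k
      have := hα k
      field_simp
    simp only [e]
    rw [← mul_assoc, one_div_mul_cancel hn0, hC]
    ring
  · simp only [lse, Fin.cons_succ, hXy]
    have := hα k
    field_simp
end

section
/- For the generic quadratic model f with an admissible design x_1,…,x_n, true parameter θ* ∈ ℝ^{d+1} and Gaussian noise of standard deviation σ > 0, the expected prediction satisfies, for every x ∈ [−1,1]^d: μ(x) = f(x, θ*) + (σ^2/(2n)) Σ_{k=1}^d (β_k/α_k^2) (x_k^2 − 1). -/
open Finset MeasureTheory Real

/-- Density of the `n`-dimensional Gaussian with mean `0` and covariance `σ² I`. -/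
noncomputable def gauss (n : ℕ) (σ : ℝ) (z : Fin n → ℝ) : ℝ :=
  (2 * π * σ ^ 2) ^ (-(n : ℝ) / 2) * Real.exp (-(∑ i, (z i) ^ 2) / (2 * σ ^ 2))

/-- The noise-free observations `y* = (f(x₁,θ*),…,f(xₙ,θ*))`. -/
noncomputable def yStar (d n : ℕ) (α β : Fin d → ℝ) (X : Fin n → Fin d → ℝ)
    (θs : Fin (d + 1) → ℝ) : Fin n → ℝ :=
  fun i => model d α β (X i) θs

/-- The expected prediction `μ(x) = ∫ f(x, θ̂(y* + z)) p(z) dz`. -/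
noncomputable def predMean (d n : ℕ) (α β : Fin d → ℝ) (X : Fin n → Fin d → ℝ)
    (θs : Fin (d + 1) → ℝ) (σ : ℝ) (x : Fin d → ℝ) : ℝ :=
  ∫ z : Fin n → ℝ, model d α β x (lse d n α β X (yStar d n α β X θs + z)) * gauss n σ z

/-- The prediction uncertainty `V(x) = ∫ (f(x, θ̂(y* + z)) − μ(x))² p(z) dz`. -/
noncomputable def predVar (d n : ℕ) (α β : Fin d → ℝ) (X : Fin n → Fin d → ℝ)
    (θs : Fin (d + 1) → ℝ) (σ : ℝ) (x : Fin d → ℝ) : ℝ :=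
  ∫ z : Fin n → ℝ,
    (model d α β x (lse d n α β X (yStar d n α β X θs + z))
        - predMean d n α β X θs σ x) ^ 2 * gauss n σ z

theorem gauss_eq_prod (n : ℕ) (σ : ℝ) (hσ : 0 < σ) (z : Fin n → ℝ) :
    gauss n σ z = ∏ i, ProbabilityTheory.gaussianPDFReal 0 (Real.toNNReal (σ ^ 2)) (z i) := by
  have hp : 0 ≤ 2 * π * σ ^ 2 := by positivity
  simp only [gauss, ProbabilityTheory.gaussianPDFReal, Finset.prod_mul_distrib, Finset.prod_const,
    Finset.card_univ, Fintype.card_fin, ← Real.exp_sum, sub_zero, Real.coe_toNNReal _ (sq_nonneg σ)]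
  congr 1
  · rw [Real.sqrt_eq_rpow, ← Real.rpow_neg hp, ← Real.rpow_natCast _ n, ← Real.rpow_mul hp]
    congr 1
    ring
  · rw [← Finset.sum_div, Finset.sum_neg_distrib]

theorem pdf_integrable (σ : ℝ) (hσ : 0 < σ) (p : ℕ) :
    Integrable (fun t : ℝ => t ^ p *
      ProbabilityTheory.gaussianPDFReal 0 (Real.toNNReal (σ ^ 2)) t) := by
  have hb : 0 < 1 / (2 * σ ^ 2) := by positivity
  have h := integrable_rpow_mul_exp_neg_mul_sq hb (s := (p : ℝ))
    (by have : (0 : ℝ) ≤ p := p.cast_nonneg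
        linarith)
  refine (h.mul_const ((√(2 * π * σ ^ 2))⁻¹)).congr (Filter.Eventually.of_forall fun t => ?_)
  simp only [ProbabilityTheory.gaussianPDFReal, sub_zero, Real.coe_toNNReal _ (sq_nonneg σ), Real.rpow_natCast]
  have : -(1 / (2 * σ ^ 2)) * t ^ 2 = -t ^ 2 / (2 * σ ^ 2) := by ring
  rw [this]
  ring

theorem v_ne (σ : ℝ) (hσ : 0 < σ) : Real.toNNReal (σ ^ 2) ≠ 0 :=
  (Real.toNNReal_pos.2 (pow_pos hσ 2)).ne'

theorem pdf_m0 (σ : ℝ) (hσ : 0 < σ) :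
    ∫ t : ℝ, t ^ 0 * ProbabilityTheory.gaussianPDFReal 0 (Real.toNNReal (σ ^ 2)) t = 1 := by
  simpa using ProbabilityTheory.integral_gaussianPDFReal_eq_one 0 (v_ne σ hσ)

theorem pdf_m1 (σ : ℝ) (hσ : 0 < σ) :
    ∫ t : ℝ, t ^ 1 * ProbabilityTheory.gaussianPDFReal 0 (Real.toNNReal (σ ^ 2)) t = 0 := by
  have h := ProbabilityTheory.integral_id_gaussianReal (μ := 0) (v := (Real.toNNReal (σ ^ 2)))
  rw [ProbabilityTheory.integral_gaussianReal_eq_integral_smul (v_ne σ hσ)] at h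
  simpa [mul_comm] using h

theorem pdf_m2 (σ : ℝ) (hσ : 0 < σ) :
    ∫ t : ℝ, t ^ 2 * ProbabilityTheory.gaussianPDFReal 0 (Real.toNNReal (σ ^ 2)) t = σ ^ 2 := by
  have h := ProbabilityTheory.variance_fun_id_gaussianReal (μ := 0) (v := (Real.toNNReal (σ ^ 2)))
  rw [ProbabilityTheory.variance_eq_integral measurable_id'.aemeasurable,
    ProbabilityTheory.integral_id_gaussianReal,
    ProbabilityTheory.integral_gaussianReal_eq_integral_smul (v_ne σ hσ)] at h
  simpa [mul_comm, sq_nonneg σ] using h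

theorem mono_eq (n : ℕ) (σ : ℝ) (hσ : 0 < σ) (e : Fin n → ℕ) (z : Fin n → ℝ) :
    (∏ k, z k ^ e k) * gauss n σ z =
      ∏ k, (z k ^ e k * ProbabilityTheory.gaussianPDFReal 0 (Real.toNNReal (σ ^ 2)) (z k)) := by
  rw [gauss_eq_prod n σ hσ, Finset.prod_mul_distrib]

theorem mono_integrable (n : ℕ) (σ : ℝ) (hσ : 0 < σ) (e : Fin n → ℕ) :
    Integrable (fun z : Fin n → ℝ => (∏ k, z k ^ e k) * gauss n σ z) := by
  simp only [mono_eq n σ hσ]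
  exact Integrable.fintype_prod (f := fun k t => t ^ e k *
    ProbabilityTheory.gaussianPDFReal 0 (Real.toNNReal (σ ^ 2)) t) fun k => pdf_integrable σ hσ (e k)

theorem mono_integral (n : ℕ) (σ : ℝ) (hσ : 0 < σ) (e : Fin n → ℕ) :
    ∫ z : Fin n → ℝ, (∏ k, z k ^ e k) * gauss n σ z =
      ∏ k, ∫ t : ℝ, t ^ e k *
        ProbabilityTheory.gaussianPDFReal 0 (Real.toNNReal (σ ^ 2)) t := by
  simp only [mono_eq n σ hσ]
  exact integral_fintype_prod_volume_eq_prod (fun k t => t ^ e k *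
    ProbabilityTheory.gaussianPDFReal 0 (Real.toNNReal (σ ^ 2)) t)

theorem prod_single {n : ℕ} (i : Fin n) (z : Fin n → ℝ) :
    ∏ k, z k ^ (if k = i then 1 else 0) = z i := by
  simp [pow_ite]

theorem prod_double {n : ℕ} (i j : Fin n) (z : Fin n → ℝ) :
    ∏ k, z k ^ ((if k = i then 1 else 0) + (if k = j then 1 else 0)) = z i * z j := by
  simp only [pow_add, Finset.prod_mul_distrib, prod_single]

theorem int0 (n : ℕ) (σ : ℝ) (hσ : 0 < σ) :
    Integrable (gauss n σ) ∧ ∫ z, gauss n σ z = 1 := by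
  have h1 := mono_integrable n σ hσ (fun _ => 0)
  have h2 := mono_integral n σ hσ (fun _ => 0)
  simp only [pdf_m0 σ hσ] at h2
  simp only [pow_zero, Finset.prod_const_one, one_mul] at h1 h2
  exact ⟨h1, h2⟩

theorem int1 (n : ℕ) (σ : ℝ) (hσ : 0 < σ) (i : Fin n) :
    Integrable (fun z : Fin n → ℝ => z i * gauss n σ z) ∧
      ∫ z : Fin n → ℝ, z i * gauss n σ z = 0 := by
  have h1 := mono_integrable n σ hσ (fun k => if k = i then 1 else 0)
  have h2 := mono_integral n σ hσ (fun k => if k = i then 1 else 0)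
  simp only [prod_single] at h1 h2
  refine ⟨h1, h2.trans (Finset.prod_eq_zero (Finset.mem_univ i) ?_)⟩
  rw [if_pos rfl]
  exact pdf_m1 σ hσ

theorem int2 (n : ℕ) (σ : ℝ) (hσ : 0 < σ) (i j : Fin n) :
    Integrable (fun z : Fin n → ℝ => z i * z j * gauss n σ z) ∧
      ∫ z : Fin n → ℝ, z i * z j * gauss n σ z = if i = j then σ ^ 2 else 0 := by
  have h1 := mono_integrable n σ hσ
    (fun k => (if k = i then 1 else 0) + (if k = j then 1 else 0))
  have h2 := mono_integral n σ hσ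
    (fun k => (if k = i then 1 else 0) + (if k = j then 1 else 0))
  simp only [prod_double] at h1 h2
  refine ⟨h1, h2.trans ?_⟩
  split_ifs with hij
  · subst hij
    rw [Finset.prod_eq_single i]
    · simp only [if_true]
      exact pdf_m2 σ hσ
    · intro k _ hk
      simp only [if_neg hk]
      exact pdf_m0 σ hσ
    · simp
  · refine Finset.prod_eq_zero (Finset.mem_univ i) ?_
    simp only [if_true, if_neg hij]
    exact pdf_m1 σ hσ

theorem quad_integral (n : ℕ) (σ : ℝ) (hσ : 0 < σ) (A : ℝ) (L : Fin n → ℝ)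
    (Q : Fin n → Fin n → ℝ) :
    ∫ z : Fin n → ℝ, (A + ∑ i, L i * z i + ∑ i, ∑ j, Q i j * (z i * z j)) * gauss n σ z
      = A + σ ^ 2 * ∑ i, Q i i := by
  have e : ∀ z : Fin n → ℝ,
      (A + ∑ i, L i * z i + ∑ i, ∑ j, Q i j * (z i * z j)) * gauss n σ z
      = A * gauss n σ z + ∑ i, L i * (z i * gauss n σ z)
        + ∑ i, ∑ j, Q i j * (z i * z j * gauss n σ z) := by
    intro z
    simp only [add_mul, Finset.sum_mul, mul_assoc]
  simp only [e]
  have i0 := (int0 n σ hσ).1.const_mul A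
  have i1 := fun i => (int1 n σ hσ i).1.const_mul (L i)
  have i2 := fun i j => (int2 n σ hσ i j).1.const_mul (Q i j)
  have s1 := integrable_finsetSum Finset.univ (fun i _ => i1 i)
  have s2' := fun i => integrable_finsetSum Finset.univ (fun j _ => i2 i j)
  have s2 := integrable_finsetSum Finset.univ (fun i _ => s2' i)
  have s01 : Integrable (fun z : Fin n → ℝ => A * gauss n σ z + ∑ i, L i * (z i * gauss n σ z)) :=
    i0.add s1
  rw [integral_add s01 s2, integral_add i0 s1,
    integral_finsetSum _ (fun i _ => i1 i), integral_finsetSum _ (fun i _ => s2' i)]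
  simp_rw [integral_finsetSum Finset.univ (fun j _ => i2 _ j), integral_const_mul,
    (int0 n σ hσ).2, (int1 n σ hσ _).2, (int2 n σ hσ _ _).2]
  simp [Finset.mul_sum, mul_comm]

/-- Closed-form expression for the expected prediction. -/
theorem stmt4 (d n : ℕ) (hd : 1 ≤ d) (hn : 1 ≤ n)
    (α β : Fin d → ℝ) (hα : ∀ k, α k ≠ 0)
    (X : Fin n → Fin d → ℝ) (hX : Admissible d n X)
    (θs : Fin (d + 1) → ℝ) (σ : ℝ) (hσ : 0 < σ)
    (x : Fin d → ℝ) (hx : ∀ k, x k ∈ Set.Icc (-1 : ℝ) 1) :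
    predMean d n α β X θs σ x
      = model d α β x θs
        + σ ^ 2 / (2 * (n : ℝ)) * ∑ k, β k / (α k) ^ 2 * ((x k) ^ 2 - 1) := by
  obtain ⟨h1, h2, h3⟩ := hX
  have hn0 : (n : ℝ) ≠ 0 := by
    have : n ≠ 0 := by omega
    exact_mod_cast this
  have hsq : ∀ i k, X i k ^ 2 = 1 := by
    intro i k
    rcases h1 i k with h | h <;> rw [h] <;> norm_num
  -- the noise-free data
  have hy : ∀ i, yStar d n α β X θs i =
      (θs 0 + ∑ k, β k * θs k.succ ^ 2 / 2) + ∑ k, α k * θs k.succ * X i k := by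
    intro i
    simp only [yStar, model, hsq, mul_one]
    ring
  have hys : ∑ i, yStar d n α β X θs i = n * (θs 0 + ∑ k, β k * θs k.succ ^ 2 / 2) := by
    have e2 : ∑ i, ∑ k, α k * θs k.succ * X i k = 0 := by
      rw [Finset.sum_comm]
      exact Finset.sum_eq_zero fun k _ => by rw [← Finset.mul_sum, h2, mul_zero]
    rw [Finset.sum_congr rfl fun i _ => hy i, Finset.sum_add_distrib, e2]
    simp
    ring
  have hyk : ∀ k, ∑ i, X i k * yStar d n α β X θs i = n * (α k * θs k.succ) := by
    intro k
    have e1 : ∑ i, X i k * (θs 0 + ∑ k, β k * θs k.succ ^ 2 / 2) = 0 := by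
      rw [← Finset.sum_mul, h2, zero_mul]
    have e2 : ∀ l, ∑ i, X i k * (α l * θs l.succ * X i l)
        = (α l * θs l.succ) * (n * (if k = l then 1 else 0)) := by
      intro l
      rw [← h3 k l, Finset.mul_sum]
      exact Finset.sum_congr rfl fun i _ => by ring
    rw [Finset.sum_congr rfl fun i _ => by rw [hy i, mul_add], Finset.sum_add_distrib, e1]
    simp only [Finset.mul_sum]
    rw [Finset.sum_comm, Finset.sum_congr rfl fun l _ => e2 l]
    simp
    ring
  have hz : ∀ z : Fin n → ℝ, model d α β x (lse d n α β X (yStar d n α β X θs + z)) =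
      model d α β x θs
      + ∑ i, (1 / n + ∑ k, (x k / n + β k / (α k * n) * θs k.succ * (x k ^ 2 - 1)) * X i k) * z i
      + ∑ i, ∑ j, (∑ k, β k / (2 * α k ^ 2 * n ^ 2) * (x k ^ 2 - 1) * X i k * X j k)
          * (z i * z j) := by
    intro z
    have f1 : ∑ i, (1 / n + ∑ k, (x k / n + β k / (α k * n) * θs k.succ * (x k ^ 2 - 1)) * X i k)
        * z i = 1 / n * ∑ i, z i +
        ∑ k, (x k / n + β k / (α k * n) * θs k.succ * (x k ^ 2 - 1)) * ∑ i, X i k * z i := by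
      simp only [add_mul (1 / (n : ℝ)), Finset.sum_add_distrib (s := (Finset.univ : Finset (Fin n))), Finset.mul_sum,
        Finset.sum_mul]
      rw [Finset.sum_comm (s := (Finset.univ : Finset (Fin n)))]
      simp only [mul_assoc]
    have f2 : ∑ i, ∑ j, (∑ k, β k / (2 * α k ^ 2 * n ^ 2) * (x k ^ 2 - 1) * X i k * X j k)
          * (z i * z j) = ∑ k, β k / (2 * α k ^ 2 * n ^ 2) * (x k ^ 2 - 1) *
            (∑ i, X i k * z i) ^ 2 := by
      have : ∀ k, (∑ i, X i k * z i) ^ 2 = ∑ i, ∑ j, (X i k * z i) * (X j k * z j) := by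
        intro k
        rw [sq, Finset.sum_mul_sum]
      simp only [this, Finset.mul_sum, Finset.sum_mul]
      symm
      rw [Finset.sum_comm]
      refine Finset.sum_congr rfl fun i _ => ?_
      rw [Finset.sum_comm]
      refine Finset.sum_congr rfl fun j _ => Finset.sum_congr rfl fun k _ => ?_
      ring
    rw [f1, f2]
    simp only [model, lse, Fin.cons_zero, Fin.cons_succ, Pi.add_apply, mul_add (X _ _),
      Finset.sum_add_distrib (s := (Finset.univ : Finset (Fin n))), hys, hyk]
    generalize (∑ i, z i) = s
    generalize hT : (fun k => ∑ i, X i k * z i) = T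
    have hT' : ∀ k, ∑ i, X i k * z i = T k := fun k => by rw [← hT]
    simp only [hT']
    have g : ∑ k, β k * θs k.succ ^ 2 / 2
        - ∑ k, β k / (2 * α k ^ 2 * n ^ 2) * (n * (α k * θs k.succ) + T k) ^ 2
        + ∑ k, α k * (1 / (α k * n) * (n * (α k * θs k.succ) + T k)) * x k
        + ∑ k, β k * (1 / (α k * n) * (n * (α k * θs k.succ) + T k)) ^ 2 / 2 * x k ^ 2
        = ∑ k, α k * θs k.succ * x k + ∑ k, β k * θs k.succ ^ 2 / 2 * x k ^ 2
        + ∑ k, (x k / n + β k / (α k * n) * θs k.succ * (x k ^ 2 - 1)) * T k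
        + ∑ k, β k / (2 * α k ^ 2 * n ^ 2) * (x k ^ 2 - 1) * T k ^ 2 := by
      simp only [← Finset.sum_add_distrib, ← Finset.sum_sub_distrib]
      refine Finset.sum_congr rfl fun k _ => ?_
      have := hα k
      field_simp
      ring
    have g2 : 1 / (n : ℝ) * (n * (θs 0 + ∑ k, β k * θs k.succ ^ 2 / 2) + s) =
        θs 0 + ∑ k, β k * θs k.succ ^ 2 / 2 + 1 / n * s := by
      field_simp
    rw [g2]
    linarith
  rw [predMean]
  simp only [hz]
  rw [quad_integral n σ hσ]
  congr 1
  rw [Finset.sum_comm]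
  have q : ∀ k, ∑ i, β k / (2 * α k ^ 2 * n ^ 2) * (x k ^ 2 - 1) * X i k * X i k =
      1 / (2 * n) * (β k / α k ^ 2 * (x k ^ 2 - 1)) := by
    intro k
    simp only [mul_assoc (β k / (2 * α k ^ 2 * (n : ℝ) ^ 2) * (x k ^ 2 - 1)), ← sq, hsq]
    have := hα k
    simp
    field_simp
  simp only [q, ← Finset.mul_sum]
  ring
end

section
/- For the generic quadratic model f with an admissible design x_1,…,x_n, true parameter θ* ∈ ℝ^{d+1} and Gaussian noise of standard deviation σ > 0, the prediction uncertainty satisfies, for every x ∈ [−1,1]^d: V(x) = (σ^2/n) (1 + Σ_{k=1}^d (x_k + (β_k/α_k)(x_k^2 − 1) θ*_k)^2) + (σ^4/(2n^2)) Σ_{k=1}^d (β_k^2/α_k^4) (x_k^2 − 1)^2. -/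
open Finset MeasureTheory Real

open ProbabilityTheory
open scoped NNReal ENNReal

lemma aux_deriv (p q : ℝ → ℝ) (v : ℝ) (h : ∀ t, HasDerivAt p (q t) t) :
    deriv (fun t => p t * rexp (v * t ^ 2 / 2)) =
      fun t => (q t + v * t * p t) * rexp (v * t ^ 2 / 2) := by
  funext t
  have h1 : HasDerivAt (fun t : ℝ => v * t ^ 2 / 2) (v * t) t := by
    have := ((hasDerivAt_pow 2 t).const_mul v).div_const 2
    exact this.congr_deriv (by norm_num; ring)
  have h2 : HasDerivAt (fun t => p t * rexp (v * t ^ 2 / 2)) _ t := (h t).mul h1.exp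
  rw [h2.deriv]
  ring

lemma aux_moments (v : ℝ≥0) :
    (∫ x, x ^ 3 ∂(gaussianReal 0 v) = 0) ∧ (∫ x, x ^ 4 ∂(gaussianReal 0 v) = 3 * (v : ℝ) ^ 2) := by
  have e0 : mgf (fun x : ℝ => x) (gaussianReal 0 v) =
      fun t => (fun _ => (1 : ℝ)) t * rexp ((v : ℝ) * t ^ 2 / 2) := by
    rw [mgf_fun_id_gaussianReal]; funext t; simp
  have e1 : deriv (mgf (fun x : ℝ => x) (gaussianReal 0 v)) =
      fun t => (fun t => (v : ℝ) * t) t * rexp ((v : ℝ) * t ^ 2 / 2) := by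
    rw [e0, aux_deriv _ (fun _ => 0) v (fun t => hasDerivAt_const t 1)]
    funext t; simp
  have e2 : deriv (deriv (mgf (fun x : ℝ => x) (gaussianReal 0 v))) =
      fun t => (fun t => (v : ℝ) + (v : ℝ) ^ 2 * t ^ 2) t * rexp ((v : ℝ) * t ^ 2 / 2) := by
    rw [e1, aux_deriv _ (fun _ => (v : ℝ)) v
      (fun t => by simpa using (hasDerivAt_id t).const_mul (v : ℝ))]
    funext t; simp; ring
  have e3 : deriv (deriv (deriv (mgf (fun x : ℝ => x) (gaussianReal 0 v)))) =
      fun t => (fun t => 3 * (v : ℝ) ^ 2 * t + (v : ℝ) ^ 3 * t ^ 3) t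
        * rexp ((v : ℝ) * t ^ 2 / 2) := by
    rw [e2, aux_deriv _ (fun t => (v : ℝ) ^ 2 * (2 * t)) v
      (fun t => by simpa using ((hasDerivAt_pow 2 t).const_mul ((v : ℝ) ^ 2)).const_add (v : ℝ))]
    funext t; simp; ring
  have e4 : deriv (deriv (deriv (deriv (mgf (fun x : ℝ => x) (gaussianReal 0 v))))) 0 =
      3 * (v : ℝ) ^ 2 := by
    rw [e3, aux_deriv _ (fun t => 3 * (v : ℝ) ^ 2 + (v : ℝ) ^ 3 * (3 * t ^ 2)) v
      (fun t => by
        have := ((hasDerivAt_id t).const_mul (3 * (v : ℝ) ^ 2)).add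
          ((hasDerivAt_pow 3 t).const_mul ((v : ℝ) ^ 3))
        simpa using! this)]
    simp
  have h0 : (0 : ℝ) ∈ interior (integrableExpSet (fun x : ℝ => x) (gaussianReal 0 v)) := by simp
  constructor
  · have := iteratedDeriv_mgf_zero h0 3
    simp only [iteratedDeriv_succ, iteratedDeriv_zero, e3] at this
    simpa using! this.symm
  · have := iteratedDeriv_mgf_zero h0 4
    simp only [iteratedDeriv_succ, iteratedDeriv_zero, e4] at this
    simpa using! this.symm

lemma aux_var (v : ℝ≥0) (a b : ℝ) :
    Var[fun x => a * x + b * x ^ 2; gaussianReal 0 v] =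
      a ^ 2 * v + 2 * b ^ 2 * (v : ℝ) ^ 2 := by
  obtain ⟨m3, m4⟩ := aux_moments v
  have hpow : ∀ k : ℕ, Integrable (fun x : ℝ => x ^ k) (gaussianReal 0 v) := by
    intro k
    have h := (memLp_id_gaussianReal (μ := 0) (v := v) (k : ℝ≥0)).integrable_norm_pow'
    rw [← integrable_norm_iff (by fun_prop)]
    simpa using h
  have m1 : ∫ x, x ∂(gaussianReal 0 v) = 0 := by simp
  have m2 : ∫ x, x ^ 2 ∂(gaussianReal 0 v) = v := by
    have := variance_fun_id_gaussianReal (μ := 0) (v := v)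
    rw [variance_eq_integral (by fun_prop)] at this
    simpa using this
  have i1 : Integrable (fun x : ℝ => x) (gaussianReal 0 v) := by simpa using hpow 1
  have hm : ∫ x, (a * x + b * x ^ 2) ∂(gaussianReal 0 v) = b * v := by
    rw [integral_add (i1.const_mul _) ((hpow 2).const_mul _), integral_const_mul,
      integral_const_mul, m1, m2]; ring
  rw [variance_eq_integral (by fun_prop), hm]
  have : ∀ x : ℝ, (a * x + b * x ^ 2 - b * v) ^ 2 =
      b ^ 2 * x ^ 4 + (2 * a * b * x ^ 3 + ((a ^ 2 - 2 * b ^ 2 * v) * x ^ 2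
        + (-2 * a * b * (v : ℝ) * x + b ^ 2 * v ^ 2))) := by intro x; ring
  simp_rw [this]
  have j4 := (hpow 4).const_mul (b ^ 2)
  have j3 := (hpow 3).const_mul (2 * a * b)
  have j2 := (hpow 2).const_mul (a ^ 2 - 2 * b ^ 2 * v)
  have j1 := i1.const_mul (-2 * a * b * v)
  have j0 : Integrable (fun _ : ℝ => b ^ 2 * (v : ℝ) ^ 2) (gaussianReal 0 v) :=
    integrable_const _
  have m1' : ∫ x : ℝ, -2 * a * b * (v : ℝ) * x ∂(gaussianReal 0 v) = 0 := by
    rw [integral_const_mul, m1, mul_zero]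
  have k1 : Integrable (fun x : ℝ => -2 * a * b * (v : ℝ) * x + b ^ 2 * v ^ 2) (gaussianReal 0 v) :=
    j1.add j0
  have k2 : Integrable (fun x : ℝ => (a ^ 2 - 2 * b ^ 2 * v) * x ^ 2
        + (-2 * a * b * (v : ℝ) * x + b ^ 2 * v ^ 2)) (gaussianReal 0 v) := j2.add k1
  have k3 : Integrable (fun x : ℝ => 2 * a * b * x ^ 3 + ((a ^ 2 - 2 * b ^ 2 * v) * x ^ 2
        + (-2 * a * b * (v : ℝ) * x + b ^ 2 * v ^ 2))) (gaussianReal 0 v) := j3.add k2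
  rw [integral_add j4 k3, integral_add j3 k2, integral_add j2 k1, integral_add j1 j0, m1']
  simp only [integral_const_mul, m2, m3, m4, integral_const, probReal_univ, smul_eq_mul]
  ring

lemma aux_density (n : ℕ) (v : ℝ≥0) (hv : v ≠ 0) :
    Measure.pi (fun _ : Fin n => gaussianReal 0 v) =
      (volume : Measure (Fin n → ℝ)).withDensity
        (fun z => ENNReal.ofReal (∏ i, gaussianPDFReal 0 v (z i))) := by
  refine Measure.pi_eq (fun s hs => ?_)
  have hI : Integrable (fun z : Fin n → ℝ => ∏ i, gaussianPDFReal 0 v (z i)) :=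
    Integrable.fintype_prod (fun _ => integrable_gaussianPDFReal 0 v)
  rw [withDensity_apply _ (MeasurableSet.univ_pi hs),
    ← ofReal_integral_eq_lintegral_ofReal hI.restrict
      (ae_of_all _ fun z => Finset.prod_nonneg fun i _ => gaussianPDFReal_nonneg _ _ _),
    volume_pi, Measure.restrict_pi_pi,
    integral_fintype_prod_eq_prod (f := fun (_ : Fin n) x => gaussianPDFReal 0 v x),
    ENNReal.ofReal_prod_of_nonneg
      (fun i _ => integral_nonneg fun x => gaussianPDFReal_nonneg _ _ _)]
  refine Finset.prod_congr rfl fun i _ => ?_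
  rw [gaussianReal_apply_eq_integral _ hv]

lemma aux_integral (n : ℕ) (σ : ℝ) (hσ : 0 < σ) (g : (Fin n → ℝ) → ℝ) :
    ∫ z, g z * gauss n σ z =
      ∫ z, g z ∂(Measure.pi (fun _ : Fin n => gaussianReal 0 (Real.toNNReal (σ ^ 2)))) := by
  have hv : Real.toNNReal (σ ^ 2) ≠ 0 := by
    have : 0 < σ ^ 2 := by positivity
    simpa using hσ.ne'
  have hc : ((Real.toNNReal (σ ^ 2) : ℝ≥0) : ℝ) = σ ^ 2 := Real.coe_toNNReal _ (by positivity)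
  rw [aux_density n _ hv, integral_withDensity_eq_integral_toReal_smul
    (by fun_prop) (ae_of_all _ fun _ => ENNReal.ofReal_lt_top)]
  refine integral_congr_ae (ae_of_all _ fun z => ?_)
  simp only [smul_eq_mul]
  rw [ENNReal.toReal_ofReal (Finset.prod_nonneg fun i _ => gaussianPDFReal_nonneg _ _ _), mul_comm]
  congr 1
  simp only [gaussianPDFReal, hc, Finset.prod_mul_distrib, ← Real.exp_sum, gauss]
  congr 1
  · rw [Finset.prod_const, Finset.card_univ, Fintype.card_fin, inv_pow, Real.sqrt_eq_rpow,
      ← Real.rpow_natCast (_ ^ (1 / 2 : ℝ)) n, ← Real.rpow_mul (by positivity), ← Real.rpow_neg (by positivity)]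
    congr 1; ring
  · rw [← Finset.sum_div]; simp

lemma aux_main {ι : Type*} [Fintype ι] [DecidableEq ι] (n : ℕ) (v : ℝ≥0) (c : ι → Fin n → ℝ)
    (s : ℝ) (hs : 0 ≤ s) (hc : ∀ o o', ∑ i, c o i * c o' i = if o = o' then s else 0)
    (a b : ι → ℝ) :
    Var[fun z => ∑ o, (a o * (∑ i, c o i * z i) + b o * (∑ i, c o i * z i) ^ 2);
        Measure.pi (fun _ : Fin n => gaussianReal 0 v)] =
      ∑ o, (a o ^ 2 * (s * v) + 2 * b o ^ 2 * (s * v) ^ 2) := by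
  set P := Measure.pi (fun _ : Fin n => gaussianReal 0 v) with hP
  have hmp : ∀ i, MeasurePreserving (fun z : Fin n → ℝ => z i) P (gaussianReal 0 v) :=
    fun i => measurePreserving_eval _ i
  have hG : ∀ i, HasGaussianLaw (fun z : Fin n → ℝ => z i) P := fun i =>
    ⟨by rw [(hmp i).map_eq]; infer_instance⟩
  have hI : iIndepFun (fun i (z : Fin n → ℝ) => z i) P :=
    iIndepFun_pi (X := fun (_ : Fin n) (x : ℝ) => x) (fun _ => by fun_prop)
  have hZ : HasGaussianLaw (fun z : Fin n → ℝ => (fun i => z i)) P := hI.hasGaussianLaw hG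
  let L : (Fin n → ℝ) →L[ℝ] (ι → ℝ) := ContinuousLinearMap.pi
    (fun o => ∑ i, c o i • ContinuousLinearMap.proj (R := ℝ) (φ := fun _ : Fin n => ℝ) i)
  have hL : ∀ z o, L z o = ∑ i, c o i * z i := by intro z o; simp [L]
  have hW : HasGaussianLaw (fun z : Fin n → ℝ => (fun o => ∑ i, c o i * z i)) P := by
    have := hZ.map_fun L
    have e : (fun z : Fin n → ℝ => (fun o => ∑ i, c o i * z i)) = fun z => L (fun i => z i) := by
      funext z o; exact (hL z o).symm
    rw [e]; exact this
  have hcovz : ∀ i j, cov[fun z : Fin n → ℝ => z i, fun z : Fin n → ℝ => z j; P] =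
      if i = j then (v : ℝ) else 0 := by
    intro i j
    split_ifs with h
    · subst h
      rw [covariance_self (hG i).aemeasurable, (hmp i).variance_fun_comp
        (f := fun x => x) (by fun_prop)]
      simp
    · exact (hI.indepFun h).covariance_eq_zero (hG i).memLp_two (hG j).memLp_two
  have hcov : ∀ o o', cov[fun z : Fin n → ℝ => ∑ i, c o i * z i,
      fun z : Fin n → ℝ => ∑ i, c o' i * z i; P] = if o = o' then s * v else 0 := by
    intro o o'
    rw [covariance_fun_sum_fun_sum (fun i => (hG i).memLp_two.const_mul _)
      (fun i => (hG i).memLp_two.const_mul _)]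
    simp_rw [covariance_const_mul_left, covariance_const_mul_right, hcovz]
    have : ∀ i, ∑ j, c o i * (c o' j * if i = j then (v : ℝ) else 0) = c o i * c o' i * v := by
      intro i; simp; ring
    simp_rw [this, ← Finset.sum_mul, hc]
    split_ifs <;> simp
  have hWI : iIndepFun (fun o (z : Fin n → ℝ) => ∑ i, c o i * z i) P :=
    hW.iIndepFun_of_covariance_eq_zero fun o o' h => by rw [hcov]; simp [h]
  have hmean : ∀ i, ∫ z : Fin n → ℝ, z i ∂P = 0 := by
    intro i
    have := integral_map (hG i).aemeasurable
      (f := fun x : ℝ => x) (by fun_prop)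
    rw [← this, (hmp i).map_eq]; simp
  have hlaw : ∀ o, P.map (fun z : Fin n → ℝ => ∑ i, c o i * z i) =
      gaussianReal 0 (Real.toNNReal (s * v)) := by
    intro o
    rw [(hW.eval o).map_eq_gaussianReal]
    congr 1
    · rw [integral_finsetSum _ (fun i _ => (hG i).integrable.const_mul _)]
      refine Finset.sum_eq_zero fun i _ => ?_
      rw [integral_const_mul, hmean i, mul_zero]
    · rw [← covariance_self (hW.eval o).aemeasurable, hcov]; simp
  have hY : ∀ o, MemLp (fun z : Fin n → ℝ => a o * (∑ i, c o i * z i) + b o * (∑ i, c o i * z i) ^ 2)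
      2 P := by
    intro o
    refine ((hW.eval o).memLp_two.const_mul _).add (MemLp.const_mul ?_ _)
    have h4 : MemLp (fun z : Fin n → ℝ => ∑ i, c o i * z i) 4 P := (hW.eval o).memLp (by simp)
    have : ENNReal.HolderTriple 4 4 2 := ⟨by
      have h2 : (4 : ℝ≥0∞) = 2 * 2 := by norm_num
      rw [h2, ENNReal.mul_inv (by simp) (by simp), ← mul_add, ENNReal.inv_two_add_inv_two,
        mul_one]⟩
    have := h4.mul (r := 2) h4
    simpa [pow_two, Pi.mul_def] using this
  have e : (fun z : Fin n → ℝ => ∑ o, (a o * (∑ i, c o i * z i) + b o * (∑ i, c o i * z i) ^ 2)) =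
      ∑ o, (fun z : Fin n → ℝ => a o * (∑ i, c o i * z i) + b o * (∑ i, c o i * z i) ^ 2) := by
    ext z; simp
  rw [e, IndepFun.variance_sum (fun o _ => hY o)]
  · refine Finset.sum_congr rfl fun o _ => ?_
    have := aux_var (Real.toNNReal (s * v)) (a o) (b o)
    rw [← hlaw o, variance_map (by fun_prop) (hW.eval o).aemeasurable, Real.coe_toNNReal _ (by positivity)] at this
    exact this
  · intro o _ o' _ h
    exact (hWI.indepFun h).comp (φ := fun x => a o * x + b o * x ^ 2)
      (ψ := fun x => a o' * x + b o' * x ^ 2) (by fun_prop) (by fun_prop)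

lemma aux_model (d n : ℕ) (hn : 1 ≤ n)
    (α β : Fin d → ℝ) (hα : ∀ k, α k ≠ 0)
    (X : Fin n → Fin d → ℝ) (hX : Admissible d n X)
    (θs : Fin (d + 1) → ℝ) (x : Fin d → ℝ) :
    ∃ C : ℝ, ∀ z : Fin n → ℝ, model d α β x (lse d n α β X (yStar d n α β X θs + z)) =
      C + ((1 / (n : ℝ)) * ∑ i, z i + ∑ k, ((x k + β k / α k * ((x k) ^ 2 - 1) * θs k.succ) *
        ((1 / (n : ℝ)) * ∑ i, X i k * z i) + (β k * ((x k) ^ 2 - 1) / (2 * α k ^ 2)) *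
        ((1 / (n : ℝ)) * ∑ i, X i k * z i) ^ 2)) := by
  obtain ⟨h1, h2, h3⟩ := hX
  have hn0 : (n : ℝ) ≠ 0 := by positivity
  have hsq : ∀ i k, X i k ^ 2 = 1 := by
    intro i k; rcases h1 i k with h | h <;> rw [h] <;> norm_num
  have hy : ∀ k, ∑ i, X i k * yStar d n α β X θs i = n * (α k * θs k.succ) := by
    intro k
    have : ∀ i, X i k * yStar d n α β X θs i =
        X i k * (θs 0 + ∑ l, β l * (θs l.succ) ^ 2 / 2) +
          ∑ l, α l * θs l.succ * (X i k * X i l) := by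
      intro i
      simp only [yStar, model, hsq, mul_one]
      have : ∑ l, α l * θs l.succ * (X i k * X i l) = X i k * ∑ l, α l * θs l.succ * X i l := by
        rw [Finset.mul_sum]; exact Finset.sum_congr rfl fun l _ => by ring
      rw [this]; ring
    simp_rw [this]
    rw [Finset.sum_add_distrib, ← Finset.sum_mul, h2, Finset.sum_comm]
    simp_rw [← Finset.mul_sum, h3]
    simp; ring
  refine ⟨(1 / (n : ℝ)) * (∑ i, yStar d n α β X θs i) + ∑ k, (α k * θs k.succ * x k
    + β k * (x k ^ 2 - 1) / 2 * θs k.succ ^ 2), fun z => ?_⟩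
  simp only [model, lse, Fin.cons_zero, Fin.cons_succ, Pi.add_apply, mul_add,
    Finset.sum_add_distrib, hy]
  simp only [add_sub_assoc, add_assoc]
  have hsum : (∑ k, α k * (1 / (α k * n) * (n * (α k * θs k.succ)) + 1 / (α k * n) * ∑ i, X i k * z i) * x k)
     + (∑ k, β k * (1 / (α k * n) * (n * (α k * θs k.succ)) + 1 / (α k * n) * ∑ i, X i k * z i) ^ 2 / 2 * x k ^ 2)
     - ∑ k, β k / (2 * α k ^ 2 * n ^ 2) * (n * (α k * θs k.succ) + ∑ i, X i k * z i) ^ 2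
     = ∑ k, α k * θs k.succ * x k + ∑ k, β k * (x k ^ 2 - 1) / 2 * θs k.succ ^ 2
      + ∑ k, (x k + β k / α k * ((x k) ^ 2 - 1) * θs k.succ) *
        ((1 / (n : ℝ)) * ∑ i, X i k * z i) + ∑ k, (β k * ((x k) ^ 2 - 1) / (2 * α k ^ 2)) *
        ((1 / (n : ℝ)) * ∑ i, X i k * z i) ^ 2 := by
    rw [← Finset.sum_add_distrib, ← Finset.sum_sub_distrib, ← Finset.sum_add_distrib,
      ← Finset.sum_add_distrib, ← Finset.sum_add_distrib]
    refine Finset.sum_congr rfl fun k _ => ?_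
    have := hα k
    generalize ∑ i, X i k * z i = S
    field_simp
    ring
  simp only [mul_add] at hsum
  linarith [hsum]

/-- Closed-form expression for the prediction uncertainty. -/
theorem stmt5 (d n : ℕ) (hd : 1 ≤ d) (hn : 1 ≤ n)
    (α β : Fin d → ℝ) (hα : ∀ k, α k ≠ 0)
    (X : Fin n → Fin d → ℝ) (hX : Admissible d n X)
    (θs : Fin (d + 1) → ℝ) (σ : ℝ) (hσ : 0 < σ)
    (x : Fin d → ℝ) (hx : ∀ k, x k ∈ Set.Icc (-1 : ℝ) 1) :
    predVar d n α β X θs σ x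
      = σ ^ 2 / (n : ℝ)
          * (1 + ∑ k, (x k + β k / α k * ((x k) ^ 2 - 1) * θs k.succ) ^ 2)
        + σ ^ 4 / (2 * (n : ℝ) ^ 2)
          * ∑ k, (β k) ^ 2 / (α k) ^ 4 * ((x k) ^ 2 - 1) ^ 2 := by
  obtain ⟨C, hC⟩ := aux_model d n hn α β hα X hX θs x
  obtain ⟨h1, h2, h3⟩ := hX
  have hn0 : (n : ℝ) ≠ 0 := by positivity
  have hcoe : ((Real.toNNReal (σ ^ 2) : ℝ≥0) : ℝ) = σ ^ 2 := Real.coe_toNNReal _ (by positivity)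
  let c : Option (Fin d) → Fin n → ℝ := fun o i => o.elim (1 / (n : ℝ)) (fun k => 1 / (n : ℝ) * X i k)
  let a : Option (Fin d) → ℝ := fun o => o.elim 1
    (fun k => x k + β k / α k * ((x k) ^ 2 - 1) * θs k.succ)
  let b : Option (Fin d) → ℝ := fun o => o.elim 0
    (fun k => β k * ((x k) ^ 2 - 1) / (2 * α k ^ 2))
  have hc : ∀ o o', ∑ i, c o i * c o' i = if o = o' then 1 / (n : ℝ) else 0 := by
    have hX2 : ∀ k l, ∑ i, 1 / (n : ℝ) * X i k * (1 / (n : ℝ) * X i l) =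
        if k = l then 1 / (n : ℝ) else 0 := by
      intro k l
      have : ∀ i, 1 / (n : ℝ) * X i k * (1 / (n : ℝ) * X i l) =
        1 / (n : ℝ) ^ 2 * (X i k * X i l) := by intro i; ring
      simp_rw [this, ← Finset.mul_sum, h3]
      split_ifs
      · field_simp
      · simp
    rintro (_ | k) (_ | l)
    · simp [c, hn0]
    · simp [c, ← Finset.mul_sum, h2]
    · simp [c, ← Finset.mul_sum, ← Finset.sum_mul, h2]
    · simpa [c] using hX2 k l
  have hrew : ∀ z : Fin n → ℝ, model d α β x (lse d n α β X (yStar d n α β X θs + z)) =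
      C + ∑ o, (a o * (∑ i, c o i * z i) + b o * (∑ i, c o i * z i) ^ 2) := by
    intro z
    rw [hC, Fintype.sum_option]
    simp only [a, b, c, Option.elim, Finset.mul_sum, mul_assoc]
    simp
  have hmain := aux_main n (Real.toNNReal (σ ^ 2)) c (1 / n) (by positivity) hc a b
  unfold predVar predMean
  rw [aux_integral n σ hσ, aux_integral n σ hσ]
  simp_rw [hrew]
  rw [← variance_eq_integral (by fun_prop), variance_const_add (by fun_prop), hmain, hcoe,
    Fintype.sum_option]
  simp only [a, b, Option.elim]
  rw [Finset.sum_add_distrib, mul_add, Finset.mul_sum, Finset.mul_sum]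
  have e1 : ∀ k, (x k + β k / α k * (x k ^ 2 - 1) * θs k.succ) ^ 2 * (1 / (n : ℝ) * σ ^ 2)
      = σ ^ 2 / n * (x k + β k / α k * (x k ^ 2 - 1) * θs k.succ) ^ 2 := fun k => by ring
  have e2 : ∀ k, 2 * (β k * (x k ^ 2 - 1) / (2 * α k ^ 2)) ^ 2 * (1 / (n : ℝ) * σ ^ 2) ^ 2
      = σ ^ 4 / (2 * (n : ℝ) ^ 2) * (β k ^ 2 / α k ^ 4 * (x k ^ 2 - 1) ^ 2) := fun k => by
    have := hα k
    field_simp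
  simp_rw [e1, e2]
  ring
end

section
/- For the generic quadratic model f with an admissible design x_1,…,x_n, true parameter θ* ∈ ℝ^{d+1} and Gaussian noise of standard deviation σ > 0, the predictions of the estimated model are biased: for every x ∈ [−1,1]^d such that Σ_{k=1}^d (β_k/α_k^2)(x_k^2 − 1) ≠ 0, one has μ(x) ≠ f(x, θ*). -/
open Finset MeasureTheory Real

/-- `f` is integrable with integral `v`. -/
def HasInt {n : ℕ} (f : (Fin n → ℝ) → ℝ) (v : ℝ) : Prop :=
  Integrable f ∧ ∫ z, f z = v

theorem HasInt.add {n : ℕ} {f g : (Fin n → ℝ) → ℝ} {v w : ℝ} (hf : HasInt f v)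
    (hg : HasInt g w) : HasInt (fun z => f z + g z) (v + w) :=
  ⟨hf.1.add hg.1, by rw [integral_add hf.1 hg.1, hf.2, hg.2]⟩

theorem HasInt.smul {n : ℕ} {f : (Fin n → ℝ) → ℝ} {v : ℝ} (hf : HasInt f v) (c : ℝ) :
    HasInt (fun z => c * f z) (c * v) :=
  ⟨hf.1.const_mul c, by rw [integral_const_mul, hf.2]⟩

theorem HasInt.sum {n : ℕ} {ι : Type*} [Fintype ι] {f : ι → (Fin n → ℝ) → ℝ} {v : ι → ℝ}
    (hf : ∀ i, HasInt (f i) (v i)) : HasInt (fun z => ∑ i, f i z) (∑ i, v i) :=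
  ⟨integrable_finsetSum _ fun i _ => (hf i).1, by
    rw [integral_finsetSum _ fun i _ => (hf i).1]
    exact Finset.sum_congr rfl fun i _ => (hf i).2⟩

/-- One-dimensional density. -/
noncomputable def gone (σ : ℝ) (t : ℝ) : ℝ :=
  ProbabilityTheory.gaussianPDFReal 0 (σ ^ 2).toNNReal t

theorem gone_eq (σ t : ℝ) :
    gone σ t = (√(2 * π * σ ^ 2))⁻¹ * Real.exp (-(2 * σ ^ 2)⁻¹ * t ^ 2) := by
  unfold gone ProbabilityTheory.gaussianPDFReal
  rw [Real.coe_toNNReal _ (sq_nonneg σ)]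
  congr 2
  rw [sub_zero, div_eq_mul_inv]
  ring

theorem gauss_eq (n : ℕ) (σ : ℝ) (hσ : 0 < σ) (z : Fin n → ℝ) :
    gauss n σ z = ∏ i, gone σ (z i) := by
  simp only [gone_eq]
  rw [Finset.prod_mul_distrib, ← Real.exp_sum, ← Finset.mul_sum, Finset.prod_const]
  unfold gauss
  congr 1
  · have h : (0 : ℝ) < 2 * π * σ ^ 2 := by positivity
    rw [Real.sqrt_eq_rpow, ← Real.rpow_neg h.le, ← Real.rpow_mul_natCast h.le]
    congr 1
    simp
    ring
  · congr 1
    rw [div_eq_mul_inv]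
    ring

theorem gone_integrable (σ : ℝ) (hσ : 0 < σ) (k : ℕ) :
    Integrable (fun t : ℝ => t ^ k * gone σ t) := by
  have hb : (0 : ℝ) < (2 * σ ^ 2)⁻¹ := by positivity
  have := integrable_rpow_mul_exp_neg_mul_sq hb (s := k)
    (lt_of_lt_of_le (by norm_num) (Nat.cast_nonneg k))
  refine (this.const_mul (√(2 * π * σ ^ 2))⁻¹).congr (Filter.Eventually.of_forall fun t => ?_)
  simp only [gone_eq, Real.rpow_natCast]
  ring

theorem var_ne (σ : ℝ) (hσ : 0 < σ) : (σ ^ 2).toNNReal ≠ 0 := by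
  have : 0 < (σ ^ 2).toNNReal := Real.toNNReal_pos.2 (by positivity)
  exact this.ne'

theorem mom (σ : ℝ) (hσ : 0 < σ) (k : ℕ) : ∫ t : ℝ, t ^ k * gone σ t =
    ∫ t, t ^ k ∂(ProbabilityTheory.gaussianReal 0 (σ ^ 2).toNNReal) := by
  rw [ProbabilityTheory.integral_gaussianReal_eq_integral_smul (var_ne σ hσ)]
  refine integral_congr_ae (Filter.Eventually.of_forall fun t => ?_)
  simp [gone, mul_comm]

theorem mom0 (σ : ℝ) (hσ : 0 < σ) : ∫ t : ℝ, t ^ 0 * gone σ t = 1 := by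
  rw [mom σ hσ]; simp

theorem mom1 (σ : ℝ) (hσ : 0 < σ) : ∫ t : ℝ, t ^ 1 * gone σ t = 0 := by
  rw [mom σ hσ]; simp

theorem mom2 (σ : ℝ) (hσ : 0 < σ) : ∫ t : ℝ, t ^ 2 * gone σ t = σ ^ 2 := by
  rw [mom σ hσ]
  have h := ProbabilityTheory.variance_fun_id_gaussianReal (μ := 0) (v := (σ ^ 2).toNNReal)
  rw [ProbabilityTheory.variance_eq_integral (by fun_prop)] at h
  simpa [Real.coe_toNNReal _ (sq_nonneg σ)] using h

theorem hasInt_pow (n : ℕ) (σ : ℝ) (hσ : 0 < σ) (e : Fin n → ℕ) :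
    HasInt (fun z : Fin n → ℝ => (∏ i, z i ^ e i) * gauss n σ z)
      (∏ i, ∫ t : ℝ, t ^ e i * gone σ t) := by
  have h : (fun z : Fin n → ℝ => (∏ i, z i ^ e i) * gauss n σ z) =
      fun z => ∏ i, (fun t : ℝ => t ^ e i * gone σ t) (z i) := by
    funext z
    rw [gauss_eq n σ hσ, Finset.prod_mul_distrib]
  rw [h]
  exact ⟨Integrable.fintype_prod (f := fun i (t : ℝ) => t ^ e i * gone σ t)
    fun i => gone_integrable σ hσ (e i),
    integral_fintype_prod_volume_eq_prod (fun i (t : ℝ) => t ^ e i * gone σ t)⟩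

theorem hasInt_zero (n : ℕ) (σ : ℝ) (hσ : 0 < σ) : HasInt (gauss n σ) 1 := by
  have := hasInt_pow n σ hσ (fun _ => 0)
  rw [mom0 σ hσ] at this
  simpa using this

theorem hasInt_one (n : ℕ) (σ : ℝ) (hσ : 0 < σ) (i : Fin n) :
    HasInt (fun z => z i * gauss n σ z) 0 := by
  have := hasInt_pow n σ hσ (fun m => if m = i then 1 else 0)
  rw [Finset.prod_eq_zero (Finset.mem_univ i) (by simpa using mom1 σ hσ)] at this
  simpa [Finset.prod_pow_boole] using this

theorem hasInt_two (n : ℕ) (σ : ℝ) (hσ : 0 < σ) (i j : Fin n) :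
    HasInt (fun z => z i * z j * gauss n σ z) (if i = j then σ ^ 2 else 0) := by
  have := hasInt_pow n σ hσ (fun m => (if m = i then 1 else 0) + if m = j then 1 else 0)
  have hv : (∏ m, ∫ t : ℝ, t ^ ((if m = i then 1 else 0) + if m = j then 1 else 0) * gone σ t)
      = if i = j then σ ^ 2 else 0 := by
    split_ifs with h
    · subst h
      rw [Finset.prod_eq_single i]
      · simpa using mom2 σ hσ
      · intro m _ hm
        simpa [hm] using mom0 σ hσ
      · simp
    · exact Finset.prod_eq_zero (Finset.mem_univ i) (by simpa [h] using mom1 σ hσ)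
  rw [hv] at this
  simp only [pow_add, Finset.prod_mul_distrib] at this
  simpa [Finset.prod_pow_boole] using this

theorem hasInt_lin (n : ℕ) (σ : ℝ) (hσ : 0 < σ) (c : Fin n → ℝ) :
    HasInt (fun z => (∑ i, c i * z i) * gauss n σ z) 0 := by
  have := HasInt.sum fun i => (hasInt_one n σ hσ i).smul (c i)
  simpa [Finset.sum_mul, mul_assoc] using this

theorem hasInt_quad (n : ℕ) (σ : ℝ) (hσ : 0 < σ) (c : Fin n → ℝ) :
    HasInt (fun z => (∑ i, c i * z i) ^ 2 * gauss n σ z) (σ ^ 2 * ∑ i, c i * c i) := by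
  have := HasInt.sum fun i => HasInt.sum fun j => (hasInt_two n σ hσ i j).smul (c i * c j)
  convert this using 1
  · funext z
    rw [sq, Finset.sum_mul_sum, Finset.sum_mul]
    refine Finset.sum_congr rfl fun i _ => ?_
    rw [Finset.sum_mul]
    exact Finset.sum_congr rfl fun j _ => by ring
  · simp [Finset.mul_sum, mul_comm]

theorem sum_yStar (d n : ℕ) (α β : Fin d → ℝ) (X : Fin n → Fin d → ℝ) (hX : Admissible d n X)
    (θs : Fin (d + 1) → ℝ) :
    ∑ i, yStar d n α β X θs i = n * (θs 0 + ∑ k, β k * θs k.succ ^ 2 / 2) := by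
  obtain ⟨h1, h2, h3⟩ := hX
  have hs : ∀ i k, X i k ^ 2 = 1 := fun i k => by rcases h1 i k with h | h <;> simp [h]
  simp only [yStar, model, hs, mul_one, Finset.sum_add_distrib]
  rw [Finset.sum_comm]
  simp only [← Finset.mul_sum, h2]
  simp
  ring

theorem sum_X_yStar (d n : ℕ) (α β : Fin d → ℝ) (X : Fin n → Fin d → ℝ)
    (hX : Admissible d n X) (θs : Fin (d + 1) → ℝ) (l : Fin d) :
    ∑ i, X i l * yStar d n α β X θs i = n * (α l * θs l.succ) := by
  obtain ⟨h1, h2, h3⟩ := hX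
  have hs : ∀ i k, X i k ^ 2 = 1 := fun i k => by rcases h1 i k with h | h <;> simp [h]
  simp only [yStar, model, hs, mul_one, mul_add, Finset.sum_add_distrib]
  rw [← Finset.sum_mul, ← Finset.sum_mul, h2]
  have : ∑ i, X i l * ∑ k, α k * θs k.succ * X i k
      = ∑ k, α k * θs k.succ * ∑ i, X i l * X i k := by
    simp only [Finset.mul_sum]
    rw [Finset.sum_comm]
    exact Finset.sum_congr rfl fun i _ => Finset.sum_congr rfl fun j _ => by ring
  rw [this]
  simp only [h3]
  simp
  ring

theorem pred_eq (d n : ℕ) (hn : 1 ≤ n) (α β : Fin d → ℝ) (hα : ∀ k, α k ≠ 0)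
    (X : Fin n → Fin d → ℝ) (hX : Admissible d n X)
    (θs : Fin (d + 1) → ℝ) (x : Fin d → ℝ) (z : Fin n → ℝ) :
    model d α β x (lse d n α β X (yStar d n α β X θs + z)) =
      model d α β x θs + ((∑ i, (1 / (n : ℝ)) * z i) +
      ∑ k, ((x k / n + β k * θs k.succ / (α k * n) * (x k ^ 2 - 1)) * (∑ i, X i k * z i) +
        (β k / α k ^ 2 * (x k ^ 2 - 1) / (2 * n ^ 2)) * (∑ i, X i k * z i) ^ 2)) := by
  have hn0 : (n : ℝ) ≠ 0 := by positivity
  simp only [model, lse, Fin.cons_zero, Fin.cons_succ, Pi.add_apply, mul_add,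
    Finset.sum_add_distrib, sum_yStar d n α β X hX, sum_X_yStar d n α β X hX]
  have e1 : ∑ i, 1 / (n : ℝ) * z i = 1 / (n : ℝ) * ∑ i, z i := by rw [Finset.mul_sum]
  rw [e1]
  have e2 : 1 / (n : ℝ) * (n * θs 0) = θs 0 := by field_simp
  have e3 : ∀ S : ℝ, 1 / (n : ℝ) * (n * S) = S := fun S => by field_simp
  rw [e2, e3]
  have key : (∑ k, β k * θs k.succ ^ 2 / 2)
      - ∑ k, β k / (2 * α k ^ 2 * (n : ℝ) ^ 2) * (n * (α k * θs k.succ) + ∑ i, X i k * z i) ^ 2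
      + ∑ k, (α k * (1 / (α k * n) * (n * (α k * θs k.succ)))
          + α k * (1 / (α k * n) * ∑ i, X i k * z i))
        * x k
      + ∑ k, β k * (1 / (α k * n) * (n * (α k * θs k.succ))
        + 1 / (α k * n) * ∑ i, X i k * z i) ^ 2 / 2 * x k ^ 2
      = ∑ k, α k * θs k.succ * x k + ∑ k, β k * θs k.succ ^ 2 / 2 * x k ^ 2
      + (∑ k, (x k / n + β k * θs k.succ / (α k * n) * (x k ^ 2 - 1)) * (∑ i, X i k * z i)
      + ∑ k, (β k / α k ^ 2 * (x k ^ 2 - 1) / (2 * n ^ 2)) * (∑ i, X i k * z i) ^ 2) := by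
    simp only [← Finset.sum_add_distrib, ← Finset.sum_sub_distrib]
    refine Finset.sum_congr rfl fun k _ => ?_
    have := hα k
    field_simp
    ring
  linarith [key]

theorem predMean_eq (d n : ℕ) (hn : 1 ≤ n) (α β : Fin d → ℝ) (hα : ∀ k, α k ≠ 0)
    (X : Fin n → Fin d → ℝ) (hX : Admissible d n X)
    (θs : Fin (d + 1) → ℝ) (σ : ℝ) (hσ : 0 < σ) (x : Fin d → ℝ) :
    predMean d n α β X θs σ x = model d α β x θs +
      σ ^ 2 / (2 * n) * ∑ k, β k / (α k) ^ 2 * ((x k) ^ 2 - 1) := by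
  have hn0 : (n : ℝ) ≠ 0 := by positivity
  have H := ((hasInt_zero n σ hσ).smul (model d α β x θs)).add
    ((hasInt_lin n σ hσ (fun _ => 1 / (n : ℝ))).add (HasInt.sum fun k : Fin d =>
      ((hasInt_lin n σ hσ (fun i => X i k)).smul
        (x k / n + β k * θs k.succ / (α k * n) * (x k ^ 2 - 1))).add
      ((hasInt_quad n σ hσ (fun i => X i k)).smul
        (β k / α k ^ 2 * (x k ^ 2 - 1) / (2 * n ^ 2)))))
  unfold predMean
  refine (integral_congr_ae (Filter.Eventually.of_forall fun z => ?_)).trans (H.2.trans ?_)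
  · beta_reduce
    rw [pred_eq d n hn α β hα X hX θs x z, add_mul, add_mul]
    congr 2
    rw [Finset.sum_mul]
    exact Finset.sum_congr rfl fun k _ => by ring
  simp only [hX.2.2, Finset.mul_sum]
  simp only [if_true, mul_one, mul_zero, zero_add]
  congr 1
  refine Finset.sum_congr rfl fun k _ => ?_
  field_simp

/-- The predictions of the estimated model are biased. -/
theorem stmt6 (d n : ℕ) (hd : 1 ≤ d) (hn : 1 ≤ n)
    (α β : Fin d → ℝ) (hα : ∀ k, α k ≠ 0)
    (X : Fin n → Fin d → ℝ) (hX : Admissible d n X)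
    (θs : Fin (d + 1) → ℝ) (σ : ℝ) (hσ : 0 < σ)
    (x : Fin d → ℝ) (hx : ∀ k, x k ∈ Set.Icc (-1 : ℝ) 1)
    (hne : (∑ k, β k / (α k) ^ 2 * ((x k) ^ 2 - 1)) ≠ 0) :
    predMean d n α β X θs σ x ≠ model d α β x θs := by
  rw [predMean_eq d n hn α β hα X hX θs σ hσ x]
  have hn0 : (0 : ℝ) < n := by exact_mod_cast hn
  have : σ ^ 2 / (2 * n) * ∑ k, β k / (α k) ^ 2 * ((x k) ^ 2 - 1) ≠ 0 :=
    mul_ne_zero (by positivity) hne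
  simpa using this
end

section
/- For the generic quadratic model f with an admissible design x_1,…,x_n and true parameter θ* ∈ ℝ^{d+1}, set y* = (f(x_1,θ*),…,f(x_n,θ*)). Then for every perturbation z = (z_1,…,z_n) ∈ ℝ^n and every x ∈ [−1,1]^d, the prediction error decomposes as: f(x, θ̂(y* + z)) − f(x, θ*) = (1/n) Σ_{i=1}^n z_i + Σ_{k=1}^d (1/n) (Σ_{i=1}^n x_{i,k} z_i) · (x_k + (β_k/α_k) θ*_k (x_k^2 − 1)) + Σ_{k=1}^d (β_k/(2 α_k^2 n^2)) (Σ_{i=1}^n x_{i,k} z_i)^2 · (x_k^2 − 1). -/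
open Finset MeasureTheory Real

/-- Decomposition of the prediction error under a perturbation `z`. -/
theorem stmt7 (d n : ℕ) (hd : 1 ≤ d) (hn : 1 ≤ n)
    (α β : Fin d → ℝ) (hα : ∀ k, α k ≠ 0)
    (X : Fin n → Fin d → ℝ) (hX : Admissible d n X)
    (θs : Fin (d + 1) → ℝ) (z : Fin n → ℝ)
    (x : Fin d → ℝ) (hx : ∀ k, x k ∈ Set.Icc (-1 : ℝ) 1) :
    model d α β x (lse d n α β X (yStar d n α β X θs + z)) - model d α β x θs
      = (1 / (n : ℝ)) * (∑ i, z i)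
        + (∑ k, (1 / (n : ℝ)) * (∑ i, X i k * z i)
            * (x k + β k / α k * θs k.succ * ((x k) ^ 2 - 1)))
        + ∑ k, β k / (2 * (α k) ^ 2 * (n : ℝ) ^ 2) * (∑ i, X i k * z i) ^ 2
            * ((x k) ^ 2 - 1) := by
  obtain ⟨h1, h2, h3⟩ := hX
  have hn0 : (n : ℝ) ≠ 0 := by
    have : n ≠ 0 := by omega
    exact_mod_cast this
  have hsq : ∀ i k, X i k ^ 2 = 1 := by
    intro i k
    rcases h1 i k with h | h <;> rw [h] <;> norm_num
  have hlin : ∀ k, ∑ i, X i k * (∑ l, α l * θs l.succ * X i l) = n * (α k * θs k.succ) := by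
    intro k
    calc ∑ i, X i k * (∑ l, α l * θs l.succ * X i l)
        = ∑ i, ∑ l, α l * θs l.succ * (X i k * X i l) := by
          refine Finset.sum_congr rfl fun i _ => ?_
          rw [Finset.mul_sum]
          exact Finset.sum_congr rfl fun l _ => by ring
      _ = ∑ l, α l * θs l.succ * ∑ i, X i k * X i l := by
          rw [Finset.sum_comm]
          exact Finset.sum_congr rfl fun l _ => by rw [Finset.mul_sum]
      _ = n * (α k * θs k.succ) := by
          simp only [h3]
          simp
          ring
  have hlin0 : ∑ i, (∑ l, α l * θs l.succ * X i l) = 0 := by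
    rw [Finset.sum_comm]
    refine Finset.sum_eq_zero fun l _ => ?_
    rw [← Finset.mul_sum, h2, mul_zero]
  have hS : ∑ i, (yStar d n α β X θs + z) i
      = n * (θs 0 + ∑ k, β k * (θs k.succ) ^ 2 / 2) + ∑ i, z i := by
    simp only [Pi.add_apply, yStar, model, hsq, mul_one, Finset.sum_add_distrib, hlin0]
    simp
    ring
  have hT : ∀ k, ∑ i, X i k * (yStar d n α β X θs + z) i
      = n * (α k * θs k.succ) + ∑ i, X i k * z i := by
    intro k
    simp only [Pi.add_apply, yStar, model, hsq, mul_one, mul_add, Finset.sum_add_distrib, hlin,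
      ← Finset.sum_mul, h2]
    ring
  unfold model lse
  simp only [Fin.cons_zero, Fin.cons_succ, hS, hT]
  generalize ∑ i, z i = s
  have key : ∀ k, ∀ t : ℝ,
      - (β k / (2 * (α k) ^ 2 * (n : ℝ) ^ 2) * (n * (α k * θs k.succ) + t) ^ 2)
      + α k * (1 / (α k * (n : ℝ)) * (n * (α k * θs k.succ) + t)) * x k
      + β k * (1 / (α k * (n : ℝ)) * (n * (α k * θs k.succ) + t)) ^ 2 / 2 * (x k) ^ 2
      + β k * (θs k.succ) ^ 2 / 2
      - α k * θs k.succ * x k - β k * (θs k.succ) ^ 2 / 2 * (x k) ^ 2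
      = (1 / (n : ℝ)) * t * (x k + β k / α k * θs k.succ * ((x k) ^ 2 - 1))
        + β k / (2 * (α k) ^ 2 * (n : ℝ) ^ 2) * t ^ 2 * ((x k) ^ 2 - 1) := by
    intro k t
    have := hα k
    field_simp
    ring
  have hsum := Finset.sum_congr (rfl : (Finset.univ : Finset (Fin d)) = Finset.univ)
    fun k _ => key k (∑ i, X i k * z i)
  simp only [Finset.sum_add_distrib, Finset.sum_sub_distrib, Finset.sum_neg_distrib] at hsum
  have h0 : 1 / (n : ℝ) * (n * (θs 0 + ∑ k, β k * (θs k.succ) ^ 2 / 2) + s)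
      = θs 0 + ∑ k, β k * (θs k.succ) ^ 2 / 2 + 1 / (n : ℝ) * s := by
    field_simp
  rw [h0]
  linarith
end

section
/- For the generic quadratic model f with an admissible design x_1,…,x_n, any reference parameter θ̄ = (θ̄_0,…,θ̄_d) ∈ ℝ^{d+1}, and arbitrary observations y ∈ ℝ^n, the linearized sum of squared errors S^LIN(θ) = Σ_{i=1}^n (f^LIN_θ̄(x_i,θ) − y_i)^2 has a unique global minimizer over ℝ^{d+1}, given by θ̂^LIN = (θ̂_0,…,θ̂_d) with θ̂_0 = (1/n) Σ_{i=1}^n z_i − Σ_{k=1}^d (β_k θ̄_k/(α_k n)) Σ_{i=1}^n x_{i,k} z_i and θ̂_k = (1/(α_k n)) Σ_{i=1}^n x_{i,k} z_i for k = 1,…,d, where z_i = y_i − c_θ̄(x_i) and c_θ̄(x) = f(x,θ̄) − ∇_θ f(x,θ̄)^T θ̄. -/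
open Finset MeasureTheory Real

/-- The gradient `∇_θ f(x,θ̄)` of the generic quadratic model:
`∂f/∂θ₀ = 1` and `∂f/∂θₖ = αₖ xₖ + βₖ θ̄ₖ xₖ²`. -/
noncomputable def gradModel (d : ℕ) (α β : Fin d → ℝ) (x : Fin d → ℝ)
    (θb : Fin (d + 1) → ℝ) : Fin (d + 1) → ℝ :=
  Fin.cons 1 (fun k => α k * x k + β k * θb k.succ * (x k) ^ 2)

/-- The linearized model `f^LIN_θ̄(x,θ) = f(x,θ̄) + ∇_θ f(x,θ̄)ᵀ (θ − θ̄)`. -/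
noncomputable def modelLin (d : ℕ) (α β : Fin d → ℝ) (θb : Fin (d + 1) → ℝ)
    (x : Fin d → ℝ) (θ : Fin (d + 1) → ℝ) : ℝ :=
  model d α β x θb + ∑ j, gradModel d α β x θb j * (θ j - θb j)

/-- `c_θ̄(x) = f(x,θ̄) − ∇_θ f(x,θ̄)ᵀ θ̄`. -/
noncomputable def cRef (d : ℕ) (α β : Fin d → ℝ) (θb : Fin (d + 1) → ℝ)
    (x : Fin d → ℝ) : ℝ :=
  model d α β x θb - ∑ j, gradModel d α β x θb j * θb j

/-- Sum of squared errors of the linearized model. -/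
noncomputable def sseLin (d n : ℕ) (α β : Fin d → ℝ) (X : Fin n → Fin d → ℝ)
    (θb : Fin (d + 1) → ℝ) (y : Fin n → ℝ) (θ : Fin (d + 1) → ℝ) : ℝ :=
  ∑ i, (modelLin d α β θb (X i) θ - y i) ^ 2

theorem aux_pair (d n : ℕ) (X : Fin n → Fin d → ℝ) (u : ℝ) (v : Fin d → ℝ) (g : Fin n → ℝ) :
    ∑ i, (u + ∑ k, v k * X i k) * g i = u * ∑ i, g i + ∑ k, v k * ∑ i, X i k * g i := by
  simp only [add_mul, Finset.sum_add_distrib, Finset.mul_sum, Finset.sum_mul]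
  rw [Finset.sum_comm]
  simp only [mul_assoc]

theorem aux_sum (d n : ℕ) (X : Fin n → Fin d → ℝ) (hX : Admissible d n X)
    (u : ℝ) (v : Fin d → ℝ) :
    ∑ i, (u + ∑ k, v k * X i k) = n * u := by
  have h := aux_pair d n X u v (fun _ => 1)
  simp only [mul_one, hX.2.1] at h
  rw [h]
  simp [mul_comm]

theorem aux_sumX (d n : ℕ) (X : Fin n → Fin d → ℝ) (hX : Admissible d n X)
    (u : ℝ) (v : Fin d → ℝ) (l : Fin d) :
    ∑ i, X i l * (u + ∑ k, v k * X i k) = n * v l := by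
  have h := aux_pair d n X u v (fun i => X i l)
  simp only [hX.2.1, hX.2.2] at h
  rw [Finset.sum_congr rfl (fun i _ => mul_comm (X i l) _), h]
  simp [mul_comm]

theorem aux_sq (d n : ℕ) (X : Fin n → Fin d → ℝ) (hX : Admissible d n X)
    (a a' : ℝ) (b b' : Fin d → ℝ) (z : Fin n → ℝ)
    (ha : n * a' = ∑ i, z i) (hb : ∀ k, n * b' k = ∑ i, X i k * z i) :
    ∑ i, (a + (∑ k, b k * X i k) - z i) ^ 2 =
      ∑ i, (a' + (∑ k, b' k * X i k) - z i) ^ 2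
        + n * ((a - a') ^ 2 + ∑ k, (b k - b' k) ^ 2) := by
  have e : ∀ i, (a + (∑ k, b k * X i k) - z i) ^ 2 =
      (a' + (∑ k, b' k * X i k) - z i) ^ 2
      + (2 * (((a - a') + ∑ k, (b k - b' k) * X i k) * (a' + (∑ k, b' k * X i k) - z i))
      + ((a - a') + ∑ k, (b k - b' k) * X i k) * ((a - a') + ∑ k, (b k - b' k) * X i k)) := by
    intro i
    simp only [sub_mul, Finset.sum_sub_distrib]
    ring
  rw [Finset.sum_congr rfl (fun i _ => e i), Finset.sum_add_distrib, Finset.sum_add_distrib,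
    ← Finset.mul_sum, aux_pair, aux_pair d n X (a - a') (fun k => b k - b' k)
      (fun i => (a - a') + ∑ k, (b k - b' k) * X i k)]
  have h1 : ∑ i, (a' + (∑ k, b' k * X i k) - z i) = 0 := by
    rw [Finset.sum_sub_distrib, aux_sum d n X hX, ha, sub_self]
  have h2 : ∀ l, ∑ i, X i l * (a' + (∑ k, b' k * X i k) - z i) = 0 := by
    intro l
    simp only [mul_sub, Finset.sum_sub_distrib]
    rw [aux_sumX d n X hX, hb, sub_self]
  rw [h1, aux_sum d n X hX]
  have h3 := aux_sumX d n X hX (a - a') (fun k => b k - b' k)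
  simp only [h2, h3]
  simp only [mul_zero, Finset.sum_const_zero]
  have : ∀ k, (b k - b' k) * (n * (b k - b' k)) = n * (b k - b' k) ^ 2 := fun k => by ring
  simp only [this, ← Finset.mul_sum]
  ring

theorem aux_lin (d n : ℕ) (α β : Fin d → ℝ) (X : Fin n → Fin d → ℝ) (hX : Admissible d n X)
    (θb : Fin (d + 1) → ℝ) (y : Fin n → ℝ) (θ : Fin (d + 1) → ℝ) :
    sseLin d n α β X θb y θ =
      ∑ i, ((θ 0 + ∑ k, β k * θb k.succ * θ k.succ) + (∑ k, (α k * θ k.succ) * X i k)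
        - (y i - cRef d α β θb (X i))) ^ 2 := by
  unfold sseLin
  refine Finset.sum_congr rfl (fun i _ => ?_)
  congr 1
  have hx : ∀ k, X i k ^ 2 = 1 := fun k => by
    rcases hX.1 i k with h | h <;> rw [h] <;> norm_num
  have h : ∑ j, gradModel d α β (X i) θb j * θ j =
      (θ 0 + ∑ k, β k * θb k.succ * θ k.succ) + (∑ k, (α k * θ k.succ) * X i k) := by
    rw [Fin.sum_univ_succ]
    simp only [gradModel, Fin.cons_zero, Fin.cons_succ, hx]
    rw [add_assoc, ← Finset.sum_add_distrib, one_mul]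
    congr 1
    exact Finset.sum_congr rfl (fun k _ => by ring)
  rw [← h]
  simp only [modelLin, cRef, mul_sub, Finset.sum_sub_distrib]
  ring

/-- The linearized sum of squared errors has a unique global minimizer,
given by the stated closed-form expression. -/
theorem stmt9 (d n : ℕ) (hd : 1 ≤ d) (hn : 1 ≤ n)
    (α β : Fin d → ℝ) (hα : ∀ k, α k ≠ 0)
    (X : Fin n → Fin d → ℝ) (hX : Admissible d n X)
    (θb : Fin (d + 1) → ℝ) (y : Fin n → ℝ) :
    ∀ θ : Fin (d + 1) → ℝ,
      θ ≠ Fin.cons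
            ((1 / (n : ℝ)) * (∑ i, (y i - cRef d α β θb (X i)))
              - ∑ k, (β k * θb k.succ / (α k * (n : ℝ)))
                  * ∑ i, X i k * (y i - cRef d α β θb (X i)))
            (fun k => (1 / (α k * (n : ℝ)))
              * ∑ i, X i k * (y i - cRef d α β θb (X i))) →
      sseLin d n α β X θb y
          (Fin.cons
            ((1 / (n : ℝ)) * (∑ i, (y i - cRef d α β θb (X i)))
              - ∑ k, (β k * θb k.succ / (α k * (n : ℝ)))
                  * ∑ i, X i k * (y i - cRef d α β θb (X i)))
            (fun k => (1 / (α k * (n : ℝ)))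
              * ∑ i, X i k * (y i - cRef d α β θb (X i))))
        < sseLin d n α β X θb y θ := by
  intro θ hθ
  have hn0 : (n : ℝ) ≠ 0 := by exact_mod_cast (by omega : n ≠ 0)
  have hnp : (0 : ℝ) < n := by exact_mod_cast hn
  rw [aux_lin d n α β X hX, aux_lin d n α β X hX]
  simp only [Fin.cons_zero, Fin.cons_succ]
  obtain ⟨z, hz⟩ : ∃ z : Fin n → ℝ, ∀ i, y i - cRef d α β θb (X i) = z i := ⟨_, fun _ => rfl⟩
  simp only [hz] at hθ ⊢
  have hs : ∑ k, β k * θb k.succ * (1 / (α k * (n : ℝ)) * ∑ i, X i k * z i) =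
      ∑ k, (β k * θb k.succ / (α k * (n : ℝ))) * ∑ i, X i k * z i :=
    Finset.sum_congr rfl (fun k _ => by ring)
  rw [hs, sub_add_cancel]
  rw [aux_sq d n X hX (θ 0 + ∑ k, β k * θb k.succ * θ k.succ) (1 / (n : ℝ) * ∑ i, z i)
    (fun k => α k * θ k.succ) (fun k => α k * (1 / (α k * (n : ℝ)) * ∑ i, X i k * z i)) z
    (by field_simp) (fun k => by have := hα k; field_simp)]
  refine lt_add_of_pos_right _ (mul_pos hnp ?_)
  have hnn : 0 ≤ ∑ k, (α k * θ k.succ - α k * (1 / (α k * (n : ℝ)) * ∑ i, X i k * z i)) ^ 2 :=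
    Finset.sum_nonneg (fun k _ => sq_nonneg _)
  refine lt_of_le_of_ne (add_nonneg (sq_nonneg _) hnn) (fun h0 => hθ ?_)
  have h1 := (add_eq_zero_iff_of_nonneg (sq_nonneg _) hnn).1 h0.symm
  have h2 : ∀ k : Fin d, θ k.succ = 1 / (α k * (n : ℝ)) * ∑ i, X i k * z i := by
    intro k
    have := (Finset.sum_eq_zero_iff_of_nonneg (fun k _ => sq_nonneg _)).1 h1.2 k
      (Finset.mem_univ k)
    exact mul_left_cancel₀ (hα k) (sub_eq_zero.1 (pow_eq_zero_iff two_ne_zero |>.1 this))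
  have h3 := sub_eq_zero.1 (pow_eq_zero_iff two_ne_zero |>.1 h1.1)
  simp only [h2] at h3
  rw [hs] at h3
  funext j
  refine Fin.cases ?_ (fun k => ?_) j
  · rw [Fin.cons_zero]
    linarith
  · rw [Fin.cons_succ]
    exact h2 k
end

section
/- For the generic quadratic model f with an admissible design x_1,…,x_n, any reference parameter θ̄ ∈ ℝ^{d+1}, and arbitrary observations y ∈ ℝ^n, the estimated linearized model satisfies, for every x ∈ [−1,1]^d: f^LIN_θ̄(x, θ̂^LIN(y)) = c_θ̄(x) + (1/n) Σ_{i=1}^n z_i + Σ_{k=1}^d (1/n) (x_k + (β_k/α_k)(x_k^2 − 1) θ̄_k) (Σ_{i=1}^n x_{i,k} z_i), where z_i = y_i − c_θ̄(x_i) and θ̂^LIN(y) is the unique minimizer of θ ↦ Σ_{i=1}^n (f^LIN_θ̄(x_i,θ) − y_i)^2. -/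
open Finset MeasureTheory Real

/-- First-order condition for a quadratic. -/
theorem aux_first_order {n : ℕ} (r g : Fin n → ℝ)
    (h : ∀ t : ℝ, ∑ i, (r i) ^ 2 ≤ ∑ i, (r i + t * g i) ^ 2) : ∑ i, r i * g i = 0 := by
  have key : ∀ t : ℝ, 0 ≤ 2 * t * (∑ i, r i * g i) + t ^ 2 * ∑ i, (g i) ^ 2 := by
    intro t
    have h1 := h t
    have h2 : ∑ i, (r i + t * g i) ^ 2
        = ∑ i, (r i) ^ 2 + (2 * t * (∑ i, r i * g i) + t ^ 2 * ∑ i, (g i) ^ 2) := by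
      simp only [Finset.mul_sum, ← Finset.sum_add_distrib]
      exact Finset.sum_congr rfl fun i _ => by ring
    linarith
  set P := ∑ i, r i * g i
  set Q := ∑ i, (g i) ^ 2 with hQ
  have hQ0 : 0 ≤ Q := Finset.sum_nonneg fun i _ => sq_nonneg _
  have h3 := key (-(P / (Q + 1)))
  have hq : Q + 1 ≠ 0 := by positivity
  have h4 : 2 * (-(P / (Q + 1))) * P + (-(P / (Q + 1))) ^ 2 * Q
      = -(P ^ 2 * ((Q + 2) / (Q + 1) ^ 2)) := by
    field_simp
    ring
  rw [h4] at h3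
  have h5 : 0 < (Q + 2) / (Q + 1) ^ 2 := by positivity
  have h6 : P ^ 2 ≤ 0 := by
    by_contra hc
    push Not at hc
    have := mul_pos hc h5
    linarith
  exact pow_eq_zero_iff (two_ne_zero) |>.1 (le_antisymm h6 (sq_nonneg P))

theorem aux_modelLin (d : ℕ) (α β : Fin d → ℝ) (θb : Fin (d + 1) → ℝ)
    (x : Fin d → ℝ) (θ : Fin (d + 1) → ℝ) :
    modelLin d α β θb x θ = cRef d α β θb x + θ 0
      + ∑ k, (α k * x k + β k * θb k.succ * (x k) ^ 2) * θ k.succ := by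
  simp only [modelLin, cRef, gradModel, Fin.sum_univ_succ, Fin.cons_zero, Fin.cons_succ, mul_sub,
    Finset.sum_sub_distrib]
  ring

theorem aux_dir (d : ℕ) (α β : Fin d → ℝ) (θb : Fin (d + 1) → ℝ)
    (x : Fin d → ℝ) (θ δ : Fin (d + 1) → ℝ) (t : ℝ) :
    modelLin d α β θb x (fun j => θ j + t * δ j) = modelLin d α β θb x θ
      + t * (δ 0 + ∑ k, (α k * x k + β k * θb k.succ * (x k) ^ 2) * δ k.succ) := by
  rw [aux_modelLin, aux_modelLin]
  simp only [mul_add, Finset.sum_add_distrib, Finset.mul_sum]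
  have : ∀ k : Fin d, (α k * x k + β k * θb k.succ * (x k) ^ 2) * (t * δ k.succ)
    = t * ((α k * x k + β k * θb k.succ * (x k) ^ 2) * δ k.succ) := fun k => by ring
  simp only [this]
  ring

/-- Closed-form expression for the estimated linearized model. -/
theorem stmt10 (d n : ℕ) (hd : 1 ≤ d) (hn : 1 ≤ n)
    (α β : Fin d → ℝ) (hα : ∀ k, α k ≠ 0)
    (X : Fin n → Fin d → ℝ) (hX : Admissible d n X)
    (θb : Fin (d + 1) → ℝ) (y : Fin n → ℝ)
    (tL : Fin (d + 1) → ℝ)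
    (htL : ∀ θ : Fin (d + 1) → ℝ, sseLin d n α β X θb y tL ≤ sseLin d n α β X θb y θ)
    (x : Fin d → ℝ) (hx : ∀ k, x k ∈ Set.Icc (-1 : ℝ) 1) :
    modelLin d α β θb x tL
      = cRef d α β θb x + (1 / (n : ℝ)) * (∑ i, (y i - cRef d α β θb (X i)))
        + ∑ k, (1 / (n : ℝ)) * (x k + β k / α k * ((x k) ^ 2 - 1) * θb k.succ)
            * (∑ i, X i k * (y i - cRef d α β θb (X i))) := by
  obtain ⟨h1, h2, h3⟩ := hX
  have hsq : ∀ i k, X i k ^ 2 = 1 := by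
    intro i k
    rcases h1 i k with h | h <;> rw [h] <;> norm_num
  have hn0 : (n : ℝ) ≠ 0 := by
    have : n ≠ 0 := by omega
    exact_mod_cast this
  have hdir : ∀ δ : Fin (d + 1) → ℝ, ∑ i, (modelLin d α β θb (X i) tL - y i)
      * (δ 0 + ∑ k, (α k * X i k + β k * θb k.succ * (X i k) ^ 2) * δ k.succ) = 0 := by
    intro δ
    apply aux_first_order
    intro t
    have h := htL (fun j => tL j + t * δ j)
    simp only [sseLin, aux_dir] at h
    refine h.trans (le_of_eq (Finset.sum_congr rfl fun i _ => by ring))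
  have e0 : ∑ i, (modelLin d α β θb (X i) tL - y i) = 0 := by
    have h := hdir (Fin.cons 1 (fun _ => 0))
    simpa using h
  have ek : ∀ k, ∑ i, (modelLin d α β θb (X i) tL - y i) * X i k = 0 := by
    intro k
    have h := hdir (Fin.cons 0 (Pi.single k 1))
    simp only [Fin.cons_zero, Fin.cons_succ, Pi.single_apply, mul_ite, mul_one, mul_zero,
      Finset.sum_ite_eq', Finset.mem_univ, if_true, zero_add, hsq] at h
    have h' : α k * ∑ i, (modelLin d α β θb (X i) tL - y i) * X i k
        + β k * θb k.succ * ∑ i, (modelLin d α β θb (X i) tL - y i) = 0 := by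
      rw [← h, Finset.mul_sum, Finset.mul_sum, ← Finset.sum_add_distrib]
      exact Finset.sum_congr rfl fun i _ => by ring
    rw [e0, mul_zero, add_zero] at h'
    exact (mul_eq_zero.1 h').resolve_left (hα k)
  set z : Fin n → ℝ := fun i => y i - cRef d α β θb (X i) with hz
  set a : ℝ := tL 0 + ∑ k, β k * θb k.succ * tL k.succ with ha
  have hr : ∀ i, modelLin d α β θb (X i) tL - y i
      = a + ∑ k, X i k * (α k * tL k.succ) - z i := by
    intro i
    rw [aux_modelLin]
    have : ∑ k, (α k * X i k + β k * θb k.succ * (X i k) ^ 2) * tL k.succ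
        = ∑ k, β k * θb k.succ * tL k.succ + ∑ k, X i k * (α k * tL k.succ) := by
      rw [← Finset.sum_add_distrib]
      exact Finset.sum_congr rfl fun k _ => by rw [hsq]; ring
    rw [this]
    simp only [hz, ha]
    ring
  have E0 : ∑ i, z i = n * a := by
    simp only [hr, Finset.sum_sub_distrib, Finset.sum_add_distrib] at e0
    rw [Finset.sum_comm] at e0
    simp only [← Finset.sum_mul, h2] at e0
    simp at e0
    linarith
  have Ek : ∀ l, ∑ i, X i l * z i = n * (α l * tL l.succ) := by
    intro l
    have h := ek l
    have hs : ∀ i, (modelLin d α β θb (X i) tL - y i) * X i l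
        = a * X i l + ∑ k, (X i k * X i l) * (α k * tL k.succ) - X i l * z i := by
      intro i
      rw [hr, sub_mul, add_mul, Finset.sum_mul, mul_comm (z i)]
      congr 2
      exact Finset.sum_congr rfl fun k _ => by ring
    simp only [hs, Finset.sum_sub_distrib, Finset.sum_add_distrib] at h
    rw [Finset.sum_comm] at h
    simp only [← Finset.sum_mul, ← Finset.mul_sum, h2, h3] at h
    simp at h
    linarith
  rw [aux_modelLin]
  change _ = cRef d α β θb x + 1 / (n : ℝ) * (∑ i, z i) + ∑ k, (1 / (n : ℝ)) * (x k + β k / α k * ((x k) ^ 2 - 1) * θb k.succ) * (∑ i, X i k * z i)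
  simp only [E0, Ek]
  have hfin : ∀ k, (1 / (n : ℝ)) * (x k + β k / α k * ((x k) ^ 2 - 1) * θb k.succ)
      * (n * (α k * tL k.succ))
      = (α k * x k + β k * θb k.succ * (x k) ^ 2) * tL k.succ - β k * θb k.succ * tL k.succ := by
    intro k
    have := hα k
    field_simp
    ring
  simp only [hfin, Finset.sum_sub_distrib]
  rw [ha]
  field_simp
  ring
end

section
/- For the generic quadratic model f with an admissible design x_1,…,x_n, observations y ∈ ℝ^n, reference parameter θ̄ = θ̂(y), noise level σ > 0, and sigma-point parameter κ ∈ (−n, ∞): for every x ∈ [−1,1]^d, the sigma-point approximation to the prediction uncertainty equals V^SP(x) = (σ^2/n) (1 + Σ_{k=1}^d (x_k + (β_k/α_k)(x_k^2 − 1) θ̄_k)^2) + (κ/n) (σ^4/(4n^2)) (Σ_{k=1}^d (β_k/α_k^2)(x_k^2 − 1))^2. -/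
open Finset MeasureTheory Real

/-- `g(x,z) = f(x, θ̂(ȳ + z))` where `ȳ` are the predictions of the model estimated from `y`. -/
noncomputable def spG (d n : ℕ) (α β : Fin d → ℝ) (X : Fin n → Fin d → ℝ)
    (y : Fin n → ℝ) (x : Fin d → ℝ) (z : Fin n → ℝ) : ℝ :=
  model d α β x (lse d n α β X ((fun i => model d α β (X i) (lse d n α β X y)) + z))

/-- The sigma-point approximation to the expected prediction. -/
noncomputable def spMean (d n : ℕ) (α β : Fin d → ℝ) (X : Fin n → Fin d → ℝ)
    (y : Fin n → ℝ) (σ κ : ℝ) (x : Fin d → ℝ) : ℝ :=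
  (κ / ((n : ℝ) + κ)) * spG d n α β X y x 0
    + (1 / (2 * ((n : ℝ) + κ))) * ∑ i : Fin n,
        (spG d n α β X y x (fun j => if j = i then σ * Real.sqrt ((n : ℝ) + κ) else 0)
          + spG d n α β X y x (fun j => if j = i then -(σ * Real.sqrt ((n : ℝ) + κ)) else 0))

/-- The sigma-point approximation to the prediction uncertainty. -/
noncomputable def spVar (d n : ℕ) (α β : Fin d → ℝ) (X : Fin n → Fin d → ℝ)
    (y : Fin n → ℝ) (σ κ : ℝ) (x : Fin d → ℝ) : ℝ :=
  (κ / ((n : ℝ) + κ)) * (spG d n α β X y x 0 - spMean d n α β X y σ κ x) ^ 2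
    + (1 / (2 * ((n : ℝ) + κ))) * ∑ i : Fin n,
        ((spG d n α β X y x (fun j => if j = i then σ * Real.sqrt ((n : ℝ) + κ) else 0)
            - spMean d n α β X y σ κ x) ^ 2
          + (spG d n α β X y x (fun j => if j = i then -(σ * Real.sqrt ((n : ℝ) + κ)) else 0)
              - spMean d n α β X y σ κ x) ^ 2)

theorem sum_X_model (d n : ℕ) (α β : Fin d → ℝ)
    (X : Fin n → Fin d → ℝ) (hX : Admissible d n X) (θ : Fin (d + 1) → ℝ) (k : Fin d) :
    ∑ i, X i k * model d α β (X i) θ = (n : ℝ) * (α k * θ k.succ) := by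
  obtain ⟨h1, h2, h3⟩ := hX
  have hsq : ∀ i k, X i k ^ 2 = 1 := by
    intro i k
    rcases h1 i k with h | h <;> rw [h] <;> norm_num
  have e : ∀ i, X i k * model d α β (X i) θ
      = X i k * (θ 0 + ∑ l, β l * (θ l.succ) ^ 2 / 2)
        + ∑ l, (α l * θ l.succ) * (X i k * X i l) := by
    intro i
    unfold model
    simp only [hsq, mul_one]
    rw [add_right_comm, mul_add, mul_sum]
    congr 1
    exact sum_congr rfl fun l _ => by ring
  simp only [e]
  rw [sum_add_distrib, ← sum_mul, h2, sum_comm]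
  simp only [← mul_sum, h3]
  simp [mul_comm]

theorem sum_model (d n : ℕ) (α β : Fin d → ℝ)
    (X : Fin n → Fin d → ℝ) (hX : Admissible d n X) (θ : Fin (d + 1) → ℝ) :
    ∑ i, model d α β (X i) θ = (n : ℝ) * (θ 0 + ∑ l, β l * (θ l.succ) ^ 2 / 2) := by
  obtain ⟨h1, h2, h3⟩ := hX
  have hsq : ∀ i k, X i k ^ 2 = 1 := by
    intro i k
    rcases h1 i k with h | h <;> rw [h] <;> norm_num
  unfold model
  simp only [hsq, mul_one]
  rw [sum_add_distrib, sum_add_distrib, sum_comm]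
  simp only [← mul_sum, h2]
  simp
  ring

theorem model_lse (d n : ℕ) (hn : 1 ≤ n) (α β : Fin d → ℝ) (hα : ∀ k, α k ≠ 0)
    (X : Fin n → Fin d → ℝ) (x : Fin d → ℝ) (v : Fin n → ℝ) :
    model d α β x (lse d n α β X v) = (1 / (n : ℝ)) * (∑ i, v i)
      + ∑ k, ((∑ i, X i k * v i) * x k / n
          + β k / (2 * (α k) ^ 2 * (n : ℝ) ^ 2) * (∑ i, X i k * v i) ^ 2 * ((x k) ^ 2 - 1)) := by
  have hn0 : (n : ℝ) ≠ 0 := by positivity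
  unfold model lse
  simp only [Fin.cons_zero, Fin.cons_succ]
  rw [sub_add_eq_add_sub, sub_add_eq_add_sub, add_assoc, ← sum_add_distrib, add_sub_assoc,
    ← sum_sub_distrib]
  congr 1
  refine sum_congr rfl fun k _ => ?_
  have := hα k
  field_simp
  ring

theorem spG_single (d n : ℕ) (hn : 1 ≤ n) (α β : Fin d → ℝ) (hα : ∀ k, α k ≠ 0)
    (X : Fin n → Fin d → ℝ) (hX : Admissible d n X)
    (y : Fin n → ℝ) (x : Fin d → ℝ) (i : Fin n) (t : ℝ) :
    spG d n α β X y x (fun j => if j = i then t else 0)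
      = spG d n α β X y x 0
        + t / n * (1 + ∑ k, X i k * (x k + β k / α k * ((x k) ^ 2 - 1)
              * lse d n α β X y k.succ))
        + t ^ 2 / (2 * (n : ℝ) ^ 2) * ∑ k, β k / (α k) ^ 2 * ((x k) ^ 2 - 1) := by
  have hn0 : (n : ℝ) ≠ 0 := by positivity
  have hsq : ∀ i k, X i k ^ 2 = 1 := by
    intro i k
    rcases hX.1 i k with h | h <;> rw [h] <;> norm_num
  unfold spG
  generalize lse d n α β X y = θ
  rw [model_lse d n hn α β hα, model_lse d n hn α β hα]
  simp only [Pi.add_apply, Pi.zero_apply, add_zero, mul_add, sum_add_distrib,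
    sum_X_model d n α β X hX, sum_model d n α β X hX, mul_ite, mul_zero, sum_ite_eq', mem_univ,
    if_true]
  simp only [mul_sum, mul_one]
  have key : ∀ k, ((n * (α k * θ k.succ) + X i k * t) * x k / n
        + β k / (2 * α k ^ 2 * n ^ 2) * (n * (α k * θ k.succ) + X i k * t) ^ 2 * (x k ^ 2 - 1))
      = (n * (α k * θ k.succ)) * x k / n
        + β k / (2 * α k ^ 2 * n ^ 2) * (n * (α k * θ k.succ)) ^ 2 * (x k ^ 2 - 1)
        + (t / n * (X i k * x k) + t / n * (X i k * (β k / α k * (x k ^ 2 - 1) * θ k.succ)))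
        + t ^ 2 / (2 * (n : ℝ) ^ 2) * (β k / (α k) ^ 2 * ((x k) ^ 2 - 1)) := by
    intro k
    have := hα k
    have h := hsq i k
    field_simp
    linear_combination β k * t ^ 2 * (x k ^ 2 - 1) * h
  have key2 := sum_congr (rfl : (univ : Finset (Fin d)) = univ) fun k _ => key k
  simp only [sum_add_distrib] at key2
  linear_combination key2

/-- Closed-form expression for the sigma-point approximation to the
prediction uncertainty. -/
theorem stmt12 (d n : ℕ) (hd : 1 ≤ d) (hn : 1 ≤ n)
    (α β : Fin d → ℝ) (hα : ∀ k, α k ≠ 0)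
    (X : Fin n → Fin d → ℝ) (hX : Admissible d n X)
    (y : Fin n → ℝ) (σ κ : ℝ) (hσ : 0 < σ) (hκ : -(n : ℝ) < κ)
    (x : Fin d → ℝ) (hx : ∀ k, x k ∈ Set.Icc (-1 : ℝ) 1) :
    spVar d n α β X y σ κ x
      = σ ^ 2 / (n : ℝ)
          * (1 + ∑ k, (x k + β k / α k * ((x k) ^ 2 - 1)
              * lse d n α β X y k.succ) ^ 2)
        + κ / (n : ℝ) * (σ ^ 4 / (4 * (n : ℝ) ^ 2))
          * (∑ k, β k / (α k) ^ 2 * ((x k) ^ 2 - 1)) ^ 2 := by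
  have hn0 : (n : ℝ) ≠ 0 := by positivity
  have hN : 0 < (n : ℝ) + κ := by linarith
  have hs : Real.sqrt ((n : ℝ) + κ) ^ 2 = n + κ := Real.sq_sqrt hN.le
  unfold spVar
  have hmean : spMean d n α β X y σ κ x = spG d n α β X y x 0
      + σ ^ 2 / (2 * n) * ∑ k, β k / (α k) ^ 2 * ((x k) ^ 2 - 1) := by
    unfold spMean
    simp only [spG_single d n hn α β hα X hX]
    generalize (∑ k, β k / (α k) ^ 2 * ((x k) ^ 2 - 1)) = B
    generalize spG d n α β X y x 0 = G
    have e : ∀ (s L : ℝ), (G + s / n * L + s ^ 2 / (2 * (n : ℝ) ^ 2) * B)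
        + (G + -s / n * L + (-s) ^ 2 / (2 * (n : ℝ) ^ 2) * B)
        = 2 * G + s ^ 2 / (n : ℝ) ^ 2 * B := by intro s L; ring
    simp only [e]
    simp only [mul_pow, hs, sum_const, card_univ, Fintype.card_fin, nsmul_eq_mul]
    field_simp
    ring
  have hL : ∀ c : Fin d → ℝ, ∑ i, (1 + ∑ k, X i k * c k) ^ 2 = n * (1 + ∑ k, c k ^ 2) := by
    intro c
    obtain ⟨h1, h2, h3⟩ := hX
    have e : ∀ i, (1 + ∑ k, X i k * c k) ^ 2
        = 1 + 2 * ∑ k, X i k * c k + ∑ k, ∑ l, (X i k * X i l) * (c k * c l) := by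
      intro i
      have : (∑ k, X i k * c k) ^ 2 = ∑ k, ∑ l, (X i k * X i l) * (c k * c l) := by
        rw [sq, sum_mul_sum]
        exact sum_congr rfl fun k _ => sum_congr rfl fun l _ => by ring
      rw [← this]; ring
    simp only [e, sum_add_distrib, ← mul_sum]
    have a1 : ∑ i, ∑ k, X i k * c k = 0 := by
      rw [sum_comm]; simp only [← sum_mul, h2]; simp
    have a2 : ∑ i, ∑ k, ∑ l, (X i k * X i l) * (c k * c l) = n * ∑ k, c k ^ 2 := by
      rw [sum_comm, mul_sum]
      refine sum_congr rfl fun k _ => ?_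
      rw [sum_comm]
      simp only [← sum_mul, h3]
      simp [sq]
    rw [a1, a2]
    simp
    ring
  have hLc := hL (fun k => x k + β k / α k * ((x k) ^ 2 - 1) * lse d n α β X y k.succ)
  simp only [hmean, spG_single d n hn α β hα X hX]
  generalize (∑ k, β k / (α k) ^ 2 * ((x k) ^ 2 - 1)) = B
  generalize spG d n α β X y x 0 = G
  have e : ∀ (s L : ℝ), (G + s / n * L + s ^ 2 / (2 * (n : ℝ) ^ 2) * B
        - (G + σ ^ 2 / (2 * n) * B)) ^ 2
      + (G + -s / n * L + (-s) ^ 2 / (2 * (n : ℝ) ^ 2) * B - (G + σ ^ 2 / (2 * n) * B)) ^ 2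
      = 2 * s ^ 2 / (n : ℝ) ^ 2 * L ^ 2
        + 2 * (s ^ 2 / (2 * (n : ℝ) ^ 2) * B - σ ^ 2 / (2 * n) * B) ^ 2 := by
    intro s L; ring
  simp only [e, sum_add_distrib, ← mul_sum]
  rw [hLc]
  simp only [mul_pow, hs, sum_const, card_univ, Fintype.card_fin, nsmul_eq_mul]
  field_simp
  ring
end
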